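/- Every even integer N ≥ 4 can be written as N = p + m, where p is a prime and m is a positive integer that is a product of at most e^{29.3} primes, i.e., Ω(m) ≤ e^{29.3}, where Ω counts prime factors with multiplicity. -/

import Mathlib

namespace CW
open Finset

/-- Elementary symmetric sums over a finite set. -/
noncomputable def esym (B : ℕ) (x : ℕ → ℝ) (Q : Finset ℕ) : ℝ :=
  ∑ D ∈ Q.powersetCard B, ∏ l ∈ D, x l

lemma esym_zero (x : ℕ → ℝ) (Q : Finset ℕ) : esym 0 x Q = 1 := by
  simp [esym]

lemma esym_succ_empty (B : ℕ) (x : ℕ → ℝ) : esym (B+1) x ∅ = 0 := by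
  unfold esym
  rw [Finset.powersetCard_eq_empty.2 (by simp)]
  simp

lemma esym_insert (B : ℕ) (x : ℕ → ℝ) {Q : Finset ℕ} {a : ℕ} (h : a ∉ Q) :
    esym (B+1) x (insert a Q) = esym (B+1) x Q + x a * esym B x Q := by
  unfold esym
  rw [powersetCard_succ_insert h, sum_union, sum_image, mul_sum]
  · congr 1
    apply sum_congr rfl
    intro D hD
    rw [prod_insert]
    intro ha
    exact h ((mem_powersetCard.1 hD).1 ha)
  · intro D hD E hE hDE
    have h1 : a ∉ D := fun ha => h ((mem_powersetCard.1 hD).1 ha)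
    have h2 : a ∉ E := fun ha => h ((mem_powersetCard.1 hE).1 ha)
    have := congrArg (fun s => s.erase a) hDE
    simpa [erase_insert h1, erase_insert h2] using this
  · rw [disjoint_left]
    intro D hD hD2
    obtain ⟨E, hE, rfl⟩ := mem_image.1 hD2
    exact h ((mem_powersetCard.1 hD).1 (mem_insert_self a E))

lemma esym_nonneg (B : ℕ) (x : ℕ → ℝ) (Q : Finset ℕ) (hx : ∀ l ∈ Q, 0 ≤ x l) :
    0 ≤ esym B x Q :=
  sum_nonneg fun _ hD => prod_nonneg fun l hl => hx l ((mem_powersetCard.1 hD).1 hl)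

/-- Truncated inclusion-exclusion. -/
noncomputable def trunc (B : ℕ) (x : ℕ → ℝ) (Q : Finset ℕ) : ℝ :=
  ∑ i ∈ range B, (-1)^i * esym i x Q

lemma trunc_insert (B : ℕ) (x : ℕ → ℝ) {Q : Finset ℕ} {a : ℕ} (h : a ∉ Q) :
    trunc (B+1) x (insert a Q) = trunc (B+1) x Q - x a * trunc B x Q := by
  unfold trunc
  rw [sum_range_succ', sum_range_succ', mul_sum]
  simp only [esym_zero, esym_insert _ x h]
  have : ∀ i, (-1:ℝ)^(i+1) * (esym (i+1) x Q + x a * esym i x Q)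
      = (-1)^(i+1) * esym (i+1) x Q - x a * ((-1)^i * esym i x Q) := by
    intro i; ring
  simp only [this, sum_sub_distrib]
  ring

lemma bonferroni (x : ℕ → ℝ) (Q : Finset ℕ) (hx : ∀ l ∈ Q, 0 ≤ x l ∧ x l ≤ 1) (B : ℕ) :
    0 ≤ (-1)^B * (∏ l ∈ Q, (1 - x l) - trunc B x Q) ∧
    (-1)^B * (∏ l ∈ Q, (1 - x l) - trunc B x Q) ≤ esym B x Q := by
  induction Q using Finset.induction_on generalizing B with
  | empty =>
    cases B with
    | zero => simp [trunc, esym_zero]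
    | succ B =>
      rw [esym_succ_empty]
      have : trunc (B+1) x ∅ = 1 := by
        unfold trunc
        rw [sum_range_succ']
        simp [esym_zero, esym_succ_empty]
      simp [this]
  | insert a Q ha ih =>
    have hxQ : ∀ l ∈ Q, 0 ≤ x l ∧ x l ≤ 1 := fun l hl => hx l (mem_insert_of_mem hl)
    have hxa := hx a (mem_insert_self a Q)
    cases B with
    | zero =>
      simp only [trunc, esym_zero, range_zero, sum_empty, pow_zero, one_mul, sub_zero]
      constructor
      · exact prod_nonneg fun l hl => by linarith [(hx l hl).2]
      · exact prod_le_one (fun l hl => by linarith [(hx l hl).2])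
          (fun l hl => by linarith [(hx l hl).1])
    | succ B =>
      rw [prod_insert ha, trunc_insert _ _ ha, esym_insert _ _ ha]
      have h1 := ih hxQ (B+1)
      have h2 := ih hxQ B
      have e : (-1:ℝ)^(B+1) * ((1 - x a) * ∏ l ∈ Q, (1 - x l) -
          (trunc (B+1) x Q - x a * trunc B x Q)) =
          (-1)^(B+1) * (∏ l ∈ Q, (1 - x l) - trunc (B+1) x Q) +
          x a * ((-1)^B * (∏ l ∈ Q, (1 - x l) - trunc B x Q)) := by ring
      rw [e]
      constructor
      · exact add_nonneg h1.1 (mul_nonneg hxa.1 h2.1)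
      · exact add_le_add h1.2 (mul_le_mul_of_nonneg_left h2.2 hxa.1)

lemma bonferroni_abs (x : ℕ → ℝ) (Q : Finset ℕ) (hx : ∀ l ∈ Q, 0 ≤ x l ∧ x l ≤ 1) (B : ℕ) :
    |∏ l ∈ Q, (1 - x l) - trunc B x Q| ≤ esym B x Q := by
  obtain ⟨h1, h2⟩ := bonferroni x Q hx B
  have := abs_of_nonneg h1
  rw [abs_mul, abs_pow, abs_neg, abs_one, one_pow, one_mul] at this
  rw [this]; exact h2

lemma pow_add_mul_le (s t : ℝ) (hs : 0 ≤ s) (ht : 0 ≤ t) (B : ℕ) :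
    s^(B+1) + (B+1) * (t * s^B) ≤ (t + s)^(B+1) := by
  induction B with
  | zero => simp; linarith
  | succ B ih =>
    have h1 := mul_le_mul_of_nonneg_left ih (add_nonneg ht hs)
    have h2 : 0 ≤ (B+1) * (t * t * s^B) := by positivity
    calc s^(B+1+1) + ((B+1:ℕ)+1) * (t * s^(B+1))
        ≤ (t+s) * (s^(B+1) + (B+1) * (t * s^B)) := by
          push_cast
          have e : (t+s) * (s^(B+1) + (B+1) * (t * s^B)) = s^(B+1+1) + (B+1+1) * (t * s^(B+1))
            + (B+1) * (t * t * s^B) := by ring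
          linarith
      _ ≤ (t+s) * (t+s)^(B+1) := h1
      _ = _ := by ring

lemma esym_le (x : ℕ → ℝ) (Q : Finset ℕ) (hx : ∀ l ∈ Q, 0 ≤ x l) (B : ℕ) :
    esym B x Q ≤ (∑ l ∈ Q, x l)^B / (B.factorial : ℝ) := by
  induction Q using Finset.induction_on generalizing B with
  | empty =>
    cases B with
    | zero => simp [esym_zero]
    | succ B => rw [esym_succ_empty]; simp
  | insert a Q ha ih =>
    have hxQ : ∀ l ∈ Q, 0 ≤ x l := fun l hl => hx l (mem_insert_of_mem hl)
    have hxa := hx a (mem_insert_self a Q)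
    have hs : 0 ≤ ∑ l ∈ Q, x l := sum_nonneg hxQ
    cases B with
    | zero => simp [esym_zero]
    | succ B =>
      rw [esym_insert _ _ ha, sum_insert ha]
      set s := ∑ l ∈ Q, x l
      have h1 := ih hxQ (B+1)
      have h2 := mul_le_mul_of_nonneg_left (ih hxQ B) hxa
      have h3 : s^(B+1) + (B+1) * (x a * s^B) ≤ (x a + s)^(B+1) := by
        exact pow_add_mul_le s (x a) hs hxa B
      have hf : ((B+1).factorial : ℝ) = (B+1) * B.factorial := by
        push_cast [Nat.factorial_succ]; ring
      have hfp : (0:ℝ) < B.factorial := by positivity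
      calc esym (B+1) x Q + x a * esym B x Q
          ≤ s^(B+1) / ((B+1).factorial : ℝ) + x a * (s^B / B.factorial) := add_le_add h1 h2
        _ = (s^(B+1) + (B+1) * (x a * s^B)) / ((B+1).factorial : ℝ) := by
            rw [hf]; field_simp
        _ ≤ _ := by gcongr

lemma sum_esym_le (x : ℕ → ℝ) (Q : Finset ℕ) (hx : ∀ l ∈ Q, 0 ≤ x l) (B : ℕ) :
    ∑ i ∈ range B, esym i x Q ≤ ∏ l ∈ Q, (1 + x l) := by
  induction Q using Finset.induction_on generalizing B with
  | empty =>
    cases B with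
    | zero => simp
    | succ B => rw [sum_range_succ']; simp [esym_zero, esym_succ_empty]
  | insert a Q ha ih =>
    have hxQ : ∀ l ∈ Q, 0 ≤ x l := fun l hl => hx l (mem_insert_of_mem hl)
    have hxa := hx a (mem_insert_self a Q)
    cases B with
    | zero => simpa using prod_nonneg fun l hl => by linarith [hx l hl]
    | succ B =>
      rw [sum_range_succ', prod_insert ha]
      simp only [esym_zero, esym_insert _ x ha, sum_add_distrib, ← mul_sum]
      have h1 := ih hxQ (B+1)
      rw [sum_range_succ', esym_zero] at h1
      have h2 := mul_le_mul_of_nonneg_left (ih hxQ B) hxa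
      linarith

end CW

namespace CW
open Finset

/-- Number of `m < X` avoiding the residue sets `W l` for `l ∈ P` and lying in `W l` for `l ∈ D`. -/
def cnt (P : Finset ℕ) (W : (l : ℕ) → Finset (ZMod l)) (D : Finset ℕ) (X : ℕ) : ℕ :=
  #{m ∈ range X | (∀ l ∈ P, (m : ZMod l) ∉ W l) ∧ ∀ l ∈ D, (m : ZMod l) ∈ W l}

/-- Shifted residue system for the substitution `m = r + a n`. -/
def shift (W : (l : ℕ) → Finset (ZMod l)) (r a : ℕ) : (l : ℕ) → Finset (ZMod l) :=
  fun l => (W l).image (fun y => (y - (r : ZMod l)) * (a : ZMod l)⁻¹)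

lemma mem_shift (W : (l : ℕ) → Finset (ZMod l)) (r a l m : ℕ) (h : Nat.Coprime a l) :
    (m : ZMod l) ∈ shift W r a l ↔ ((r + a * m : ℕ) : ZMod l) ∈ W l := by
  have hu : (a : ZMod l) * (a : ZMod l)⁻¹ = 1 := ZMod.coe_mul_inv_eq_one a h
  unfold shift
  rw [mem_image]
  constructor
  · rintro ⟨y, hy, e⟩
    have : ((r + a * m : ℕ) : ZMod l) = y := by
      push_cast
      rw [← e]
      linear_combination (y - (r : ZMod l)) * hu
    rwa [this]
  · intro hm
    refine ⟨_, hm, ?_⟩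
    push_cast
    linear_combination (m : ZMod l) * hu

lemma card_shift (W : (l : ℕ) → Finset (ZMod l)) (r a l : ℕ) (h : Nat.Coprime a l) :
    #(shift W r a l) = #(W l) := by
  have hu : (a : ZMod l) * (a : ZMod l)⁻¹ = 1 := ZMod.coe_mul_inv_eq_one a h
  unfold shift
  apply card_image_of_injective
  intro x y e
  have := congrArg (fun t => t * (a : ZMod l)) e
  simp only at this
  linear_combination this - (x - y) * hu

lemma cnt_insert (P : Finset ℕ) (W : (l : ℕ) → Finset (ZMod l)) (D : Finset ℕ) (X a : ℕ)
    (ha : 0 < a) (hP : ∀ l ∈ P, Nat.Coprime a l) (hD : ∀ l ∈ D, Nat.Coprime a l) :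
    cnt P W (insert a D) X =
      ∑ r ∈ W a, cnt P (shift W r.val a) D ((X + a - 1 - r.val) / a) := by
  have : NeZero a := ⟨ha.ne'⟩
  unfold cnt
  rw [← card_sigma]
  symm
  apply card_bij (fun (x : (_ : ZMod a) × ℕ) _ => x.1.val + a * x.2)
  · rintro ⟨r, m⟩ h
    simp only [mem_sigma, mem_filter, mem_range] at h
    obtain ⟨hr, hm, h1, h2⟩ := h
    have hlt : r.val < a := ZMod.val_lt r
    simp only [mem_filter, mem_range, mem_insert, forall_eq_or_imp]
    refine ⟨?_, ?_, ?_, ?_⟩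
    · have := (Nat.lt_div_iff_mul_lt ha).1 hm
      rw [mul_comm] at this
      omega
    · intro l hl
      have := h1 l hl
      rwa [mem_shift _ _ _ _ _ (hP l hl)] at this
    · simpa using hr
    · intro l hl
      have := h2 l hl
      rwa [mem_shift _ _ _ _ _ (hD l hl)] at this
  · rintro ⟨r, m⟩ h ⟨r', m'⟩ h' e
    simp only at e
    have hlt : r.val < a := ZMod.val_lt r
    have hlt' : r'.val < a := ZMod.val_lt r'
    have e1 : r.val = r'.val := by
      have := congrArg (fun t => t % a) e
      simpa [Nat.mod_eq_of_lt hlt, Nat.mod_eq_of_lt hlt'] using this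
    have e2 : r = r' := ZMod.val_injective a e1
    subst e2
    have : m = m' := by
      have : a * m = a * m' := by omega
      exact Nat.eq_of_mul_eq_mul_left ha this
    subst this
    rfl
  · intro n hn
    simp only [mem_filter, mem_range, mem_insert, forall_eq_or_imp] at hn
    obtain ⟨hX, h1, h2, h3⟩ := hn
    have hv : ((n : ZMod a)).val = n % a := ZMod.val_natCast a n
    have e : n % a + a * (n / a) = n := Nat.mod_add_div n a
    refine ⟨⟨(n : ZMod a), n / a⟩, ?_, ?_⟩
    · simp only [mem_sigma, mem_filter, mem_range]
      refine ⟨h2, ?_, ?_, ?_⟩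
      · rw [Nat.lt_div_iff_mul_lt ha, hv, mul_comm]
        have := Nat.mod_lt n ha
        omega
      · intro l hl
        rw [mem_shift _ _ _ _ _ (hP l hl), hv, e]
        exact h1 l hl
      · intro l hl
        rw [mem_shift _ _ _ _ _ (hD l hl), hv, e]
        exact h3 l hl
    · simp only [hv, e]

/-- Uniform sieve estimate with relative error `ε` for lengths at least `Y`. -/
def Good (P : Finset ℕ) (ρ : ℕ → ℕ) (Y : ℕ) (ε : ℝ) : Prop :=
  ∀ W : (l : ℕ) → Finset (ZMod l), (∀ l ∈ P, #(W l) = ρ l) → ∀ X : ℕ, Y ≤ X →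
    |(cnt P W ∅ X : ℝ) - X * ∏ l ∈ P, (1 - (ρ l : ℝ) / l)| ≤
      ε * X * ∏ l ∈ P, (1 - (ρ l : ℝ) / l)

lemma ap_count (P : Finset ℕ) (ρ : ℕ → ℕ) (Y : ℕ) (ε : ℝ) (hε0 : 0 ≤ ε) (hε1 : ε ≤ 1)
    (hG : Good P ρ Y ε) (hP : ∀ l ∈ P, l.Prime) (hρ : ∀ l ∈ P, ρ l ≤ l)
    (D : Finset ℕ) (hD : ∀ l ∈ D, l.Prime) (hPD : Disjoint P D)
    (W : (l : ℕ) → Finset (ZMod l)) (hWP : ∀ l ∈ P, #(W l) = ρ l)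
    (hWD : ∀ l ∈ D, #(W l) = ρ l) (X : ℕ) (hX : Y * ∏ l ∈ D, l ≤ X) :
    |(cnt P W D X : ℝ) - X * (∏ l ∈ D, (ρ l : ℝ) / l) * ∏ l ∈ P, (1 - (ρ l : ℝ) / l)| ≤
      (∏ l ∈ P, (1 - (ρ l : ℝ) / l)) * (∏ l ∈ D, (ρ l : ℝ)) *
        (ε * X / (∏ l ∈ D, (l : ℝ)) + 2 * #D) := by
  induction D using Finset.induction_on generalizing W X with
  | empty =>
    simp only [prod_empty, mul_one, card_empty, Nat.cast_zero, mul_zero, add_zero, div_one]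
    have := hG W hWP X (by simpa using hX)
    linarith
  | insert a D ha ih =>
    have hap : a.Prime := hD a (mem_insert_self a D)
    have hcP : ∀ l ∈ P, Nat.Coprime a l := by
      intro l hl
      rw [Nat.coprime_primes hap (hP l hl)]
      rintro rfl
      exact disjoint_left.1 hPD hl (mem_insert_self _ _)
    have hcD : ∀ l ∈ D, Nat.Coprime a l := by
      intro l hl
      rw [Nat.coprime_primes hap (hD l (mem_insert_of_mem hl))]
      rintro rfl
      exact ha hl
    set δ := ∏ l ∈ P, (1 - (ρ l : ℝ) / l) with hδ
    have hδ0 : 0 ≤ δ := by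
      apply prod_nonneg
      intro l hl
      have : (ρ l : ℝ) ≤ l := by exact_mod_cast hρ l hl
      have hl0 : (0:ℝ) < l := by exact_mod_cast (hP l hl).pos
      rw [sub_nonneg, div_le_one hl0]; exact this
    have ha0 : (0:ℝ) < a := by exact_mod_cast hap.pos
    have ha1 : (1:ℝ) ≤ a := by exact_mod_cast hap.pos
    rw [cnt_insert P W D X a hap.pos hcP hcD, prod_insert ha, prod_insert ha, prod_insert ha,
      card_insert_of_notMem ha]
    rw [prod_insert ha] at hX
    set d := ∏ l ∈ D, (l : ℝ) with hd
    have hd1 : 1 ≤ d := by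
      have : 1 ≤ ∏ l ∈ D, l := Nat.one_le_iff_ne_zero.2
        (prod_ne_zero_iff.2 fun l hl => (hD l (mem_insert_of_mem hl)).ne_zero)
      rw [hd, ← Nat.cast_prod]; exact_mod_cast this
    set R := ∏ l ∈ D, (ρ l : ℝ) with hR
    have hR0 : 0 ≤ R := prod_nonneg fun _ _ => Nat.cast_nonneg _
    have hRd : ∏ l ∈ D, (ρ l : ℝ) / l = R / d := by rw [prod_div_distrib]
    rw [hRd]
    have key : ∀ r ∈ W a, |(cnt P (shift W r.val a) D ((X + a - 1 - r.val) / a) : ℝ) -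
        X / a * (R / d) * δ| ≤ δ * R * (ε * X / (a * d) + 2 * (#D + 1)) := by
      intro r _
      have : NeZero a := ⟨hap.ne_zero⟩
      have hr : r.val < a := ZMod.val_lt r
      set X' := (X + a - 1 - r.val) / a with hX'
      have hlo : X / a ≤ X' := Nat.div_le_div_right (by omega)
      have hhi : X' ≤ X / a + 1 := by
        rw [← Nat.add_div_right X hap.pos]
        exact Nat.div_le_div_right (by omega)
      have hXY : Y * ∏ l ∈ D, l ≤ X' := by
        refine le_trans ?_ hlo
        rw [Nat.le_div_iff_mul_le hap.pos]
        calc _ = Y * (a * ∏ l ∈ D, l) := by ring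
          _ ≤ X := hX
      have h := ih (fun l hl => hD l (mem_insert_of_mem hl))
        (disjoint_of_subset_right (subset_insert a D) hPD) (shift W r.val a)
        (fun l hl => by rw [card_shift _ _ _ _ (hcP l hl)]; exact hWP l hl)
        (fun l hl => by rw [card_shift _ _ _ _ (hcD l hl)]; exact hWD l (mem_insert_of_mem hl))
        X' hXY
      rw [hRd] at h
      have b1 : (X' : ℝ) ≤ X / a + 1 := by
        have : ((X / a : ℕ) : ℝ) ≤ X / a := Nat.cast_div_le
        have h2 : (X' : ℝ) ≤ (X / a : ℕ) + 1 := by exact_mod_cast hhi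
        linarith
      have b2 : (X : ℝ) / a - 1 ≤ X' := by
        have h2 : ((X / a : ℕ) : ℝ) ≤ X' := by exact_mod_cast hlo
        have : (X : ℝ) / a < (X / a : ℕ) + 1 := by
          rw [div_lt_iff₀ ha0]
          have := Nat.lt_div_mul_add (a := X) hap.pos
          have h3 : X < (X / a + 1) * a := by linarith
          exact_mod_cast h3
        linarith
      have b3 : |(X' : ℝ) - X / a| ≤ 1 := by rw [abs_le]; constructor <;> linarith
      have c0 : 0 ≤ R / d * δ := by positivity
      have c1 : R / d * δ ≤ R * δ := by
        apply mul_le_mul_of_nonneg_right _ hδ0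
        exact div_le_self hR0 hd1
      have e1 : |(X' : ℝ) * (R / d) * δ - X / a * (R / d) * δ| ≤ R * δ := by
        rw [show (X' : ℝ) * (R / d) * δ - X / a * (R / d) * δ = (X' - X / a) * (R / d * δ) by ring,
          abs_mul, abs_of_nonneg c0]
        calc _ ≤ 1 * (R / d * δ) := mul_le_mul_of_nonneg_right b3 c0
          _ ≤ _ := by linarith
      have e2 : ε * X' / d ≤ ε * X / (a * d) + 1 := by
        have : ε * X' / d ≤ ε * (X / a + 1) / d := by gcongr
        have h2 : ε * (X / a + 1) / d = ε * X / (a * d) + ε / d := by field_simp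
        have h3 : ε / d ≤ 1 := by rw [div_le_one (by linarith)]; linarith
        linarith
      have h5 := abs_sub_le (cnt P (shift W r.val a) D X' : ℝ) (X' * (R / d) * δ)
        (X / a * (R / d) * δ)
      calc _ ≤ _ := h5
        _ ≤ δ * R * (ε * X' / d + 2 * #D) + R * δ := add_le_add h e1
        _ ≤ δ * R * ((ε * X / (a * d) + 1) + 2 * #D) + R * δ := by gcongr
        _ = _ := by ring
    push_cast
    have hc := hWD a (mem_insert_self a D)
    have e0 : ∑ r ∈ W a, (cnt P (shift W r.val a) D ((X + a - 1 - r.val) / a) : ℝ) -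
        X * ((ρ a : ℝ) / a * (R / d)) * δ =
        ∑ r ∈ W a, ((cnt P (shift W r.val a) D ((X + a - 1 - r.val) / a) : ℝ) -
          X / a * (R / d) * δ) := by
      rw [sum_sub_distrib, sum_const, hc, nsmul_eq_mul]
      ring
    rw [e0]
    calc _ ≤ _ := abs_sum_le_sum_abs _ _
      _ ≤ ∑ r ∈ W a, δ * R * (ε * X / (a * d) + 2 * (#D + 1)) := sum_le_sum key
      _ = _ := by rw [sum_const, hc, nsmul_eq_mul]; ring

end CW

namespace CW
open Finset

lemma ite_key (p q r : Prop) [Decidable p] [Decidable q] [Decidable ((p ∧ q) ∧ r)] (hr : r) :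
    (if (p ∧ q) ∧ r then (1:ℝ) else 0) = (if p then 1 else 0) * (if q then 1 else 0) := by
  by_cases u1 : p <;> by_cases u2 : q <;> simp [u1, u2, hr]

lemma step (P Q : Finset ℕ) (ρ : ℕ → ℕ) (Y T B : ℕ) (ε ε' : ℝ) (hε0 : 0 ≤ ε) (hε1 : ε ≤ 1)
    (hG : Good P ρ Y ε) (hP : ∀ l ∈ P, l.Prime) (hQ : ∀ l ∈ Q, l.Prime)
    (hρP : ∀ l ∈ P, ρ l ≤ l) (hρQ : ∀ l ∈ Q, ρ l ≤ l)
    (hPQ : Disjoint P Q) (hT : ∀ l ∈ Q, l ≤ T) (hT1 : 1 ≤ T) (hBY : (2:ℝ) * B ≤ ε * Y)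
    (hE : 2 * ε * ∏ l ∈ Q, (1 + (ρ l : ℝ) / l) + 2 * esym B (fun l => (ρ l : ℝ) / l) Q ≤
      ε' * ∏ l ∈ Q, (1 - (ρ l : ℝ) / l)) :
    Good (P ∪ Q) ρ (Y * T ^ B) ε' := by
  classical
  intro W hW X hX
  set δ := ∏ l ∈ P, (1 - (ρ l : ℝ) / l) with hδ
  set ξ : ℕ → ℝ := fun l => (ρ l : ℝ) / l with hξ
  have hδ0 : 0 ≤ δ := by
    apply prod_nonneg
    intro l hl
    have : (ρ l : ℝ) ≤ l := by exact_mod_cast hρP l hl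
    have hl0 : (0:ℝ) < l := by exact_mod_cast (hP l hl).pos
    rw [sub_nonneg, div_le_one hl0]; exact this
  have hξ0 : ∀ l ∈ Q, 0 ≤ ξ l := fun l _ => by positivity
  have hξ1 : ∀ l ∈ Q, ξ l ≤ 1 := by
    intro l hl
    have : (ρ l : ℝ) ≤ l := by exact_mod_cast hρQ l hl
    have hl0 : (0:ℝ) < l := by exact_mod_cast (hQ l hl).pos
    simp only [hξ]
    rw [div_le_one hl0]; exact this
  let x : ℕ → ℕ → ℝ := fun m l => if (m : ZMod l) ∈ W l then 1 else 0
  let a : ℕ → ℝ := fun m => if (∀ l ∈ P, (m : ZMod l) ∉ W l) then 1 else 0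
  have ha0 : ∀ m, 0 ≤ a m := fun m => by simp only [a]; split_ifs <;> norm_num
  have hx01 : ∀ m, ∀ l ∈ Q, 0 ≤ x m l ∧ x m l ≤ 1 := fun m l _ => by
    simp only [x]; split_ifs <;> norm_num
  have h1 : ∀ D : Finset ℕ, (cnt P W D X : ℝ) = ∑ m ∈ range X, a m * ∏ l ∈ D, x m l := by
    intro D
    unfold cnt
    rw [card_filter]
    push_cast
    apply sum_congr rfl
    intro m _
    simp only [a, x]
    rw [prod_ite_zero]
    simp only [prod_const_one, ite_and]
    split_ifs <;> simp
  have h0 : (cnt (P ∪ Q) W ∅ X : ℝ) = ∑ m ∈ range X, a m * ∏ l ∈ Q, (1 - x m l) := by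
    unfold cnt
    rw [card_filter]
    push_cast
    apply sum_congr rfl
    intro m _
    have e : ∏ l ∈ Q, (1 - x m l) = if (∀ l ∈ Q, (m : ZMod l) ∉ W l) then 1 else 0 := by
      have : ∀ l ∈ Q, (1 - x m l) = if (m : ZMod l) ∉ W l then 1 else 0 := by
        intro l _
        simp only [x]
        split_ifs <;> simp_all
      rw [prod_congr rfl this, prod_ite_zero]
      simp
    rw [e]
    simp only [a, mem_union, notMem_empty, or_imp, forall_and]
    apply ite_key; intro l hl; exact hl.elim
  let C : ℕ → ℝ := fun i => ∑ D ∈ Q.powersetCard i, (cnt P W D X : ℝ)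
  have h2 : ∀ i, C i = ∑ m ∈ range X, a m * esym i (x m) Q := by
    intro i
    simp only [C, esym, mul_sum]
    rw [sum_comm]
    apply sum_congr rfl
    intro D _
    exact h1 D
  have h3 : |(cnt (P ∪ Q) W ∅ X : ℝ) - ∑ i ∈ range B, (-1)^i * C i| ≤ C B := by
    have e : (cnt (P ∪ Q) W ∅ X : ℝ) - ∑ i ∈ range B, (-1)^i * C i =
        ∑ m ∈ range X, a m * (∏ l ∈ Q, (1 - x m l) - trunc B (x m) Q) := by
      rw [h0]
      simp only [h2, trunc, mul_sub, sum_sub_distrib, mul_sum]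
      congr 1
      rw [sum_comm]
      apply sum_congr rfl
      intro m _
      apply sum_congr rfl
      intro i _
      ring
    rw [e, h2]
    refine (abs_sum_le_sum_abs _ _).trans (sum_le_sum fun m _ => ?_)
    rw [abs_mul, abs_of_nonneg (ha0 m)]
    exact mul_le_mul_of_nonneg_left (bonferroni_abs (x m) Q (hx01 m) B) (ha0 m)
  have h4 : ∀ i ≤ B, |C i - X * δ * esym i ξ Q| ≤ 2 * ε * X * δ * esym i ξ Q := by
    intro i hi
    simp only [C, esym, mul_sum]
    rw [← sum_sub_distrib]
    refine (abs_sum_le_sum_abs _ _).trans (sum_le_sum fun D hD => ?_)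
    obtain ⟨hDQ, hDc⟩ := mem_powersetCard.1 hD
    have hprod : ∏ l ∈ D, l ≤ T ^ B := by
      calc ∏ l ∈ D, l ≤ ∏ _l ∈ D, T := prod_le_prod' fun l hl => hT l (hDQ hl)
        _ = T ^ i := by rw [prod_const, hDc]
        _ ≤ T ^ B := Nat.pow_le_pow_right hT1 hi
    have hXD : Y * ∏ l ∈ D, l ≤ X := (Nat.mul_le_mul_left Y hprod).trans hX
    have h := ap_count P ρ Y ε hε0 hε1 hG hP hρP D (fun l hl => hQ l (hDQ hl))
      (disjoint_of_subset_right hDQ hPQ) W (fun l hl => hW l (mem_union_left _ hl))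
      (fun l hl => hW l (mem_union_right _ (hDQ hl))) X hXD
    rw [← hδ, hDc] at h
    have hd0 : 0 < ∏ l ∈ D, (l : ℝ) := prod_pos fun l hl => by
      exact_mod_cast (hQ l (hDQ hl)).pos
    have e1 : (2:ℝ) * i ≤ ε * X / ∏ l ∈ D, (l : ℝ) := by
      rw [le_div_iff₀ hd0]
      have r1 : (Y : ℝ) * ∏ l ∈ D, (l : ℝ) ≤ X := by
        rw [← Nat.cast_prod]; exact_mod_cast hXD
      have r2 : (i : ℝ) ≤ B := by exact_mod_cast hi
      calc (2:ℝ) * i * ∏ l ∈ D, (l : ℝ) ≤ (2 * B) * ∏ l ∈ D, (l : ℝ) := by gcongr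
        _ ≤ ε * Y * ∏ l ∈ D, (l : ℝ) := by gcongr
        _ = ε * (Y * ∏ l ∈ D, (l : ℝ)) := by ring
        _ ≤ ε * X := by gcongr
    have e2 : ∏ l ∈ D, ξ l = (∏ l ∈ D, (ρ l : ℝ)) / ∏ l ∈ D, (l : ℝ) := by
      simp only [hξ]; rw [prod_div_distrib]
    have hR0 : 0 ≤ ∏ l ∈ D, (ρ l : ℝ) := prod_nonneg fun _ _ => Nat.cast_nonneg _
    calc _ = |(cnt P W D X : ℝ) - X * (∏ l ∈ D, (ρ l : ℝ) / l) * δ| := by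
            simp only [hξ]; congr 2; ring
      _ ≤ _ := h
      _ ≤ δ * (∏ l ∈ D, (ρ l : ℝ)) *
          (ε * X / (∏ l ∈ D, (l : ℝ)) + ε * X / (∏ l ∈ D, (l : ℝ))) := by gcongr
      _ = _ := by rw [e2]; ring
  have h5 : |∏ l ∈ Q, (1 - ξ l) - trunc B ξ Q| ≤ esym B ξ Q :=
    bonferroni_abs ξ Q (fun l hl => ⟨hξ0 l hl, hξ1 l hl⟩) B
  have h6 := sum_esym_le ξ Q hξ0 (B+1)
  rw [prod_union hPQ, ← hδ]
  have hX0 : (0:ℝ) ≤ X := Nat.cast_nonneg X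
  have t1 : |∑ i ∈ range B, (-1)^i * C i - X * δ * trunc B ξ Q| ≤
      2 * ε * X * δ * ∑ i ∈ range B, esym i ξ Q := by
    unfold trunc
    rw [mul_sum, ← sum_sub_distrib, mul_sum]
    refine (abs_sum_le_sum_abs _ _).trans (sum_le_sum fun i hi => ?_)
    rw [show (-1:ℝ)^i * C i - X * δ * ((-1)^i * esym i ξ Q) =
      (-1)^i * (C i - X * δ * esym i ξ Q) by ring, abs_mul, abs_pow, abs_neg, abs_one, one_pow,
      one_mul]
    exact h4 i (mem_range.1 hi).le
  have t2 : C B ≤ X * δ * esym B ξ Q + 2 * ε * X * δ * esym B ξ Q := by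
    have := (abs_le.1 (h4 B le_rfl)).2
    linarith
  have hXδ : 0 ≤ X * δ := mul_nonneg hX0 hδ0
  have t3 : |X * δ * trunc B ξ Q - X * δ * ∏ l ∈ Q, (1 - ξ l)| ≤ X * δ * esym B ξ Q := by
    rw [← mul_sub, abs_mul, abs_of_nonneg hXδ, abs_sub_comm]
    exact mul_le_mul_of_nonneg_left h5 hXδ
  rw [sum_range_succ] at h6
  have t4 := mul_le_mul_of_nonneg_left hE hXδ
  have t5 := mul_le_mul_of_nonneg_left h6 (mul_nonneg (mul_nonneg zero_le_two hε0) hXδ)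
  have A := abs_le.1 h3
  have A1 := abs_le.1 t1
  have A3 := abs_le.1 t3
  change |(cnt (P ∪ Q) W ∅ X : ℝ) - X * (δ * ∏ l ∈ Q, (1 - ξ l))| ≤
    ε' * X * (δ * ∏ l ∈ Q, (1 - ξ l))
  have t6 : X * δ * (2 * ε * ∏ l ∈ Q, (1 + ξ l) + 2 * esym B ξ Q) ≤
    X * δ * (ε' * ∏ l ∈ Q, (1 - ξ l)) := t4
  rw [abs_le]
  constructor <;> nlinarith

end CW

namespace CW
open Finset

/-- Primes in `(A, B]`. -/
def pr (A B : ℕ) : Finset ℕ := {p ∈ Ioc A B | p.Prime}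

lemma mem_pr {A B p : ℕ} : p ∈ pr A B ↔ A < p ∧ p ≤ B ∧ p.Prime := by
  simp [pr, and_assoc]

lemma block (i : ℕ) (hi : 1 ≤ i) : ∑ l ∈ pr (2^i) (2^(i+1)), (1:ℝ)/l ≤ 2/i := by
  set m := 2^i with hm
  have hm0 : 0 < m := by positivity
  have e1 : 2^(i+1) = 2*m := by rw [hm]; ring
  rw [e1]
  have hd : ∏ p ∈ pr m (2*m), p ∣ Nat.centralBinom m := by
    apply Finset.prod_primes_dvd
    · intro p hp; exact (mem_pr.1 hp).2.2.prime
    · intro p hp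
      obtain ⟨h1, h2, h3⟩ := mem_pr.1 hp
      have h4 : p ∣ (2*m).factorial := (h3.dvd_factorial).2 h2
      rw [Nat.centralBinom_eq_two_mul_choose]
      rw [← Nat.choose_mul_factorial_mul_factorial (show m ≤ 2*m by omega)] at h4
      have e : 2*m - m = m := by omega
      rw [e] at h4
      have h5 : ¬ p ∣ m.factorial := by rw [h3.dvd_factorial]; omega
      rcases h3.dvd_mul.1 h4 with h6 | h6
      · exact (h3.dvd_mul.1 h6).resolve_right h5
      · exact absurd h6 h5
  have h1 : ∏ p ∈ pr m (2*m), p ≤ 2^(2*m) :=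
    (Nat.le_of_dvd (Nat.centralBinom_pos m) hd).trans (by
      rw [Nat.centralBinom_eq_two_mul_choose]; exact Nat.choose_le_two_pow _ _)
  have h2 : m ^ #(pr m (2*m)) ≤ ∏ p ∈ pr m (2*m), p := by
    apply Finset.pow_card_le_prod
    intro p hp; exact (mem_pr.1 hp).1.le
  have h3 : i * #(pr m (2*m)) ≤ 2*m := by
    have := h2.trans h1
    rw [hm, ← pow_mul] at this
    exact (Nat.pow_le_pow_iff_right (by norm_num)).1 this
  have h4 : ∑ l ∈ pr m (2*m), (1:ℝ)/l ≤ #(pr m (2*m)) • (1/(m:ℝ)) := by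
    apply Finset.sum_le_card_nsmul
    intro p hp
    apply one_div_le_one_div_of_le (by positivity)
    exact_mod_cast (mem_pr.1 hp).1.le
  refine h4.trans ?_
  rw [nsmul_eq_mul, mul_one_div, div_le_div_iff₀ (by positivity) (by positivity)]
  have : ((i * #(pr m (2*m)) : ℕ):ℝ) ≤ ((2*m : ℕ):ℝ) := by exact_mod_cast h3
  push_cast at this
  linarith

lemma pr_union {A B C : ℕ} (h1 : A ≤ B) (h2 : B ≤ C) : pr A B ∪ pr B C = pr A C := by
  ext p; simp only [mem_union, mem_pr]
  constructor
  · rintro (h | h)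
    · exact ⟨h.1, by omega, h.2.2⟩
    · exact ⟨by omega, h.2⟩
  · rintro ⟨h1, h2, h3⟩
    by_cases h : p ≤ B
    · left; exact ⟨h1, h, h3⟩
    · right; exact ⟨by omega, h2, h3⟩

lemma pr_disj {A B C : ℕ} : Disjoint (pr A B) (pr B C) := by
  rw [Finset.disjoint_left]; intro p h1 h2
  rw [mem_pr] at *; omega

lemma blocks (a : ℕ) (ha : 1 ≤ a) (k : ℕ) :
    ∑ l ∈ pr (2^a) (2^(a+k)), (1:ℝ)/l ≤ k * (2/a) := by
  induction k with
  | zero =>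
    have : pr (2^a) (2^(a+0)) = ∅ := by
      ext p; simp only [mem_pr, add_zero, notMem_empty, iff_false]; omega
    rw [this]; simp
  | succ k ih =>
    rw [← pr_union (B := 2^(a+k)) (Nat.pow_le_pow_right (by norm_num) (by omega))
      (Nat.pow_le_pow_right (by norm_num) (by omega)), sum_union pr_disj]
    have := block (a+k) (by omega)
    have h2 : (2:ℝ)/((a+k:ℕ):ℝ) ≤ 2/a := by
      apply div_le_div_of_nonneg_left (by norm_num) (by exact_mod_cast ha)
      push_cast; linarith [(Nat.cast_nonneg k : (0:ℝ) ≤ k)]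
    rw [show a + (k+1) = a+k+1 by ring]
    push_cast at *
    linarith

lemma recip (a : ℕ) (ha : 1 ≤ a) : ∑ l ∈ pr (2^a) (2^(2*a)), (1:ℝ)/l ≤ 2 := by
  have := blocks a ha a
  rw [show a + a = 2*a by ring] at this
  refine this.trans ?_
  have : (0:ℝ) < a := by exact_mod_cast ha
  apply le_of_eq; field_simp

lemma num1 (B : ℕ) (hB : 50 ≤ B) : 4 * (4096:ℝ) * 6^B / (B.factorial) ≤ (5/6)^(4*B+3) := by
  induction B, hB using Nat.le_induction with
  | base =>
    rw [div_le_iff₀ (by positivity)]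
    norm_num [Nat.factorial]
  | succ B hB ih =>
    rw [Nat.factorial_succ]
    have h1 : 4 * (4096:ℝ) * 6^(B+1) / (((B+1) * B.factorial : ℕ):ℝ) = (6/((B:ℝ)+1)) * (4 * (4096:ℝ) * 6^B / (B.factorial)) := by
      push_cast; field_simp; ring
    have h2 : (5/6:ℝ)^(4*(B+1)+3) = (5/6)^4 * (5/6)^(4*B+3) := by ring
    rw [h1, h2]
    have hB' : (50:ℝ) ≤ B := by exact_mod_cast hB
    apply mul_le_mul _ ih (by positivity) (by positivity)
    rw [div_le_iff₀ (by positivity)]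
    norm_num; linarith

lemma four_le {x : ℝ} (h0 : 0 ≤ x) (h1 : x ≤ 1/2) : Real.exp (-(Real.log 4 * x)) ≤ 1 - x := by
  -- convexity of exp on [0,1/2]
  have hc := convexOn_exp.2 (Set.mem_univ (0:ℝ)) (Set.mem_univ (-(Real.log 4 * (1/2))))
    (show 0 ≤ 1 - 2*x by linarith) (show 0 ≤ 2*x by linarith) (by ring)
  simp only [smul_eq_mul, Real.exp_zero, mul_zero, zero_add, mul_one] at hc
  have e1 : Real.exp (-(Real.log 4 * (1/2))) = 1/2 := by
    rw [show (4:ℝ) = 2^2 by norm_num, Real.log_pow]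
    rw [show -(((2:ℕ):ℝ) * Real.log 2 * (1/2)) = - Real.log 2 by push_cast; ring, Real.exp_neg, Real.exp_log (by norm_num)]
    norm_num
  rw [e1] at hc
  rw [show 2 * x * -(Real.log 4 * (1/2)) = -(Real.log 4 * x) by ring] at hc
  linarith

lemma prod_lower (Q : Finset ℕ) (x : ℕ → ℝ) (h : ∀ l ∈ Q, 0 ≤ x l ∧ x l ≤ 1/2) :
    Real.exp (-(Real.log 4 * ∑ l ∈ Q, x l)) ≤ ∏ l ∈ Q, (1 - x l) := by
  rw [mul_sum, ← sum_neg_distrib, Real.exp_sum]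
  apply prod_le_prod
  · intro i _; positivity
  · intro i hi; exact four_le (h i hi).1 (h i hi).2

lemma prod_upper (Q : Finset ℕ) (x : ℕ → ℝ) (h : ∀ l ∈ Q, 0 ≤ x l) :
    ∏ l ∈ Q, (1 + x l) ≤ Real.exp (∑ l ∈ Q, x l) := by
  rw [Real.exp_sum]
  apply prod_le_prod
  · intro i hi; have := h i hi; positivity
  · intro i hi; linarith [Real.add_one_le_exp (x i)]

lemma good_empty (ρ : ℕ → ℕ) (Y : ℕ) (ε : ℝ) (h : 0 ≤ ε) : Good ∅ ρ Y ε := by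
  intro W _ X _
  simp [cnt]; positivity

lemma pr16 : pr 0 16 = {2,3,5,7,11,13} := by decide

lemma FL (j : ℕ) (hj : 2 ≤ j) (ρ : ℕ → ℕ) (hρ : ∀ l, l.Prime → ρ l ≤ 3 ∧ ρ l < l) :
    ∀ s, 200 ≤ s → Good (pr 0 (2^(2^j))) ρ (2^(2^j*s)) ((5/6)^s) := by
  induction j, hj using Nat.le_induction with
  | base =>
    intro s hs
    have h2 : pr 0 (2^(2^2)) = ∅ ∪ {2,3,5,7,11,13} := by
      rw [empty_union]; exact pr16
    rw [h2]
    have hp : ∀ l ∈ ({2,3,5,7,11,13} : Finset ℕ), l.Prime := by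
      intro l hl; rw [← pr16] at hl; exact (mem_pr.1 hl).2.2
    have hY : 2^(2^2*s) = 2^(2^2*(s-7)) * 16^7 := by
      rw [show (16:ℕ) = 2^(2^2) by norm_num, ← pow_mul, ← pow_add]
      congr 1; omega
    rw [hY]
    have hlow : ∏ l ∈ ({2,3,5,7,11,13} : Finset ℕ), (1:ℝ)/l ≤ ∏ l ∈ ({2,3,5,7,11,13} : Finset ℕ), (1 - (ρ l:ℝ)/l) := by
      apply prod_le_prod
      · intro i _; positivity
      · intro i hi
        have h0 : (0:ℝ) < i := by exact_mod_cast (hp i hi).pos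
        have h1 := (hρ i (hp i hi)).2
        have h3 : (ρ i:ℝ) + 1 ≤ i := by exact_mod_cast h1
        rw [div_le_iff₀ h0, sub_mul, div_mul_cancel₀ _ h0.ne']; linarith
    have hup : ∏ l ∈ ({2,3,5,7,11,13} : Finset ℕ), (1 + (ρ l:ℝ)/l) ≤ ∏ l ∈ ({2,3,5,7,11,13} : Finset ℕ), (2:ℝ) := by
      apply prod_le_prod
      · intro i _; positivity
      · intro i hi
        have h0 : (0:ℝ) < i := by exact_mod_cast (hp i hi).pos
        have h1 := (hρ i (hp i hi)).2
        have h3 : (ρ i:ℝ) ≤ i := by exact_mod_cast h1.le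
        have : (ρ i : ℝ)/i ≤ 1 := by rw [div_le_one h0]; exact h3
        linarith
    rw [prod_const] at hup
    have hc : #({2,3,5,7,11,13} : Finset ℕ) = 6 := by decide
    rw [hc] at hup
    have hlow' : (1:ℝ)/30030 ≤ ∏ l ∈ ({2,3,5,7,11,13} : Finset ℕ), (1 - (ρ l:ℝ)/l) := by
      refine le_trans (le_of_eq ?_) hlow
      norm_num
    apply step ∅ {2,3,5,7,11,13} ρ _ 16 7 ((5/6)^s/3843840) _ (by positivity) ?_ (good_empty _ _ _ (by positivity))
      (by simp) hp (by simp) (fun l hl => (hρ l (hp l hl)).2.le) (by simp) ?_ (by norm_num) ?_ ?_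
    · have : (5/6:ℝ)^s ≤ 1 := pow_le_one₀ (by norm_num) (by norm_num)
      linarith
    · intro l hl; fin_cases hl <;> norm_num
    · obtain ⟨t, rfl⟩ : ∃ t, s = t + 50 := ⟨s - 50, by omega⟩
      have e : 2^2*(t+50-7) = 4*t + 172 := by omega
      rw [e]
      rw [Nat.cast_pow, Nat.cast_ofNat, Nat.cast_ofNat]
      have : (5/6:ℝ)^(t+50)/3843840 * 2^(4*t+172) = ((5/6)*16)^t * ((5/6)^50*2^172/3843840) := by
        rw [mul_pow, pow_add, pow_add, pow_mul]; norm_num; ring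
      rw [this]
      have h1 : (1:ℝ) ≤ ((5/6)*16)^t := one_le_pow₀ (by norm_num)
      have h2 : (14:ℝ) ≤ ((5/6)^50*2^172/3843840) := by norm_num
      calc (2:ℝ)*7 = 1 * 14 := by norm_num
        _ ≤ _ := mul_le_mul h1 h2 (by norm_num) (by linarith)
    · have e7 : esym 7 (fun l => (ρ l : ℝ) / l) {2,3,5,7,11,13} = 0 := by
        unfold esym
        rw [powersetCard_eq_empty.2 (by rw [hc]; norm_num)]; simp
      rw [e7]
      have hs0 : 0 ≤ (5/6:ℝ)^s := by positivity
      calc 2 * ((5/6:ℝ)^s/3843840) * ∏ l ∈ ({2,3,5,7,11,13} : Finset ℕ), (1 + (ρ l:ℝ)/l) + 2*0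
          ≤ 2 * ((5/6:ℝ)^s/3843840) * 2^6 + 2*0 := by gcongr
        _ = (5/6)^s * (1/30030) := by ring
        _ ≤ _ := by gcongr
  | succ j hj ih =>
    intro s hs
    obtain ⟨B, r, hr, rfl⟩ : ∃ B r, r < 4 ∧ s = 4*B + r := ⟨s/4, s%4, Nat.mod_lt _ (by norm_num), (Nat.div_add_mod s 4).symm⟩
    have hB : 50 ≤ B := by omega
    set a := 2^j with ha
    have ha4 : 4 ≤ a := by rw [ha]; exact le_trans (by norm_num) (Nat.pow_le_pow_right (by norm_num) hj)
    have e2 : 2^(j+1) = 2*a := by rw [ha]; ring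
    rw [e2, ← pr_union (A := 0) (B := 2^a) (C := 2^(2*a)) (by positivity) (Nat.pow_le_pow_right (by norm_num) (by omega))]
    have eY : 2^(2*a*(4*B+r)) = 2^(a*(6*B+2*r)) * (2^(2*a))^B := by
      rw [← pow_mul, ← pow_add]; congr 1; ring
    rw [eY]
    have hl16 : ∀ l ∈ pr (2^a) (2^(2*a)), 16 < l := by
      intro l hl
      have := (mem_pr.1 hl).1
      have h2 : 2^4 ≤ 2^a := Nat.pow_le_pow_right (by norm_num) ha4
      omega
    have hx0 : ∀ l ∈ pr (2^a) (2^(2*a)), 0 ≤ (ρ l : ℝ)/l := fun l _ => by positivity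
    have hx1 : ∀ l ∈ pr (2^a) (2^(2*a)), (ρ l : ℝ)/l ≤ 1/2 := by
      intro l hl
      have h1 := (hρ l (mem_pr.1 hl).2.2).1
      have h2 := hl16 l hl
      have h3 : (ρ l : ℝ) ≤ 3 := by exact_mod_cast h1
      have h4 : (16:ℝ) < l := by exact_mod_cast h2
      rw [div_le_iff₀ (by linarith)]; linarith
    have hσ : ∑ l ∈ pr (2^a) (2^(2*a)), (ρ l : ℝ)/l ≤ 6 := by
      calc ∑ l ∈ pr (2^a) (2^(2*a)), (ρ l : ℝ)/l ≤ ∑ l ∈ pr (2^a) (2^(2*a)), 3*((1:ℝ)/l) := by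
            apply sum_le_sum
            intro l hl
            have h1 : (ρ l : ℝ) ≤ 3 := by exact_mod_cast (hρ l (mem_pr.1 hl).2.2).1
            rw [mul_one_div]; gcongr
        _ = 3 * ∑ l ∈ pr (2^a) (2^(2*a)), (1:ℝ)/l := by rw [mul_sum]
        _ ≤ 6 := by linarith [recip a (by omega)]
    have hσ0 : 0 ≤ ∑ l ∈ pr (2^a) (2^(2*a)), (ρ l : ℝ)/l := sum_nonneg hx0
    have hup : ∏ l ∈ pr (2^a) (2^(2*a)), (1 + (ρ l:ℝ)/l) ≤ 404 := by
      refine (prod_upper _ _ hx0).trans ?_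
      refine (Real.exp_le_exp.2 hσ).trans ?_
      have h1 := Real.exp_one_lt_d9
      have : Real.exp 6 = (Real.exp 1)^6 := by rw [← Real.exp_nat_mul]; norm_num
      rw [this]
      calc (Real.exp 1)^6 ≤ 2.7182818286^6 := by gcongr
        _ ≤ 404 := by norm_num
    have hlow : (1:ℝ)/4096 ≤ ∏ l ∈ pr (2^a) (2^(2*a)), (1 - (ρ l:ℝ)/l) := by
      refine le_trans ?_ (prod_lower _ _ (fun l hl => ⟨hx0 l hl, hx1 l hl⟩))
      have : Real.exp (-(Real.log 4 * 6)) = 1/4096 := by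
        rw [Real.exp_neg, Real.exp_mul, Real.exp_log (by norm_num)]
        norm_num
      rw [← this]
      apply Real.exp_le_exp.2
      have : 0 ≤ Real.log 4 := Real.log_nonneg (by norm_num)
      nlinarith
    have hes : esym B (fun l => (ρ l : ℝ) / l) (pr (2^a) (2^(2*a))) ≤ 6^B / B.factorial := by
      refine (esym_le _ _ hx0 B).trans ?_
      gcongr
    apply step _ _ ρ _ (2^(2*a)) B ((5/6)^(6*B+2*r)) _ (by positivity) (pow_le_one₀ (by norm_num) (by norm_num))
      (ih _ (by omega)) (fun l hl => (mem_pr.1 hl).2.2) (fun l hl => (mem_pr.1 hl).2.2)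
      (fun l hl => (hρ l (mem_pr.1 hl).2.2).2.le) (fun l hl => (hρ l (mem_pr.1 hl).2.2).2.le) pr_disj
      (fun l hl => (mem_pr.1 hl).2.1) Nat.one_le_two_pow ?_ ?_
    · push_cast
      rw [pow_mul, ← mul_pow]
      have h1 : (2:ℝ) ≤ 5/6*2^a := by
        have : (2:ℝ)^4 ≤ 2^a := pow_le_pow_right₀ (by norm_num) ha4
        linarith
      calc (2:ℝ)*B ≤ ((6*B+2*r : ℕ):ℝ) := by push_cast; nlinarith [(Nat.cast_nonneg B : (0:ℝ) ≤ B), (Nat.cast_nonneg r : (0:ℝ) ≤ r)]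
        _ ≤ 2^(6*B+2*r) := by exact_mod_cast (Nat.lt_two_pow_self).le
        _ ≤ _ := by gcongr
    · have h1 : (5/6:ℝ)^(6*B+2*r) * (2*404*4096*2) ≤ (5/6)^(4*B+r) := by
        have : (5/6:ℝ)^(6*B+2*r) = (5/6)^(4*B+r) * (5/6)^(2*B+r) := by rw [← pow_add]; congr 1; ring
        rw [this]
        have h2 : (5/6:ℝ)^(2*B+r) ≤ (5/6)^100 := pow_le_pow_of_le_one (by norm_num) (by norm_num) (by omega)
        have h3 : (5/6:ℝ)^100 * (2*404*4096*2) ≤ 1 := by norm_num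
        have h4 : 0 ≤ (5/6:ℝ)^(4*B+r) := by positivity
        nlinarith
      have h2 : 2*(2*(4096:ℝ) * (6^B / B.factorial)) ≤ (5/6)^(4*B+r) := by
        have := num1 B hB
        have h3 : (5/6:ℝ)^(4*B+3) ≤ (5/6)^(4*B+r) := pow_le_pow_of_le_one (by norm_num) (by norm_num) (by omega)
        refine le_trans (le_of_eq ?_) (this.trans h3)
        ring
      have h0 : 0 ≤ (5/6:ℝ)^(4*B+r) := by positivity
      calc _ ≤ 2 * (5/6:ℝ)^(6*B+2*r) * 404 + 2 * (6^B / B.factorial) := by gcongr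
        _ ≤ (5/6:ℝ)^(4*B+r) * (1/4096) := by linarith
        _ ≤ _ := by gcongr

end CW

namespace CW
open Finset

/-- Density of a residue system. -/
noncomputable def dens (P : Finset ℕ) (W : (l : ℕ) → Finset (ZMod l)) : ℝ :=
  ∏ l ∈ P, (1 - (#(W l) : ℝ) / l)

/-- `n` survives the sieve. -/
def Sif (P : Finset ℕ) (W : (l : ℕ) → Finset (ZMod l)) (n : ℕ) : Prop :=
  ∀ l ∈ P, (n : ZMod l) ∉ W l

/-- Primes up to `2^(2^j)`. -/
def PP (j : ℕ) : Finset ℕ := pr 0 (2^(2^j))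

/-- admissible residue systems -/
def Adm (j : ℕ) (W : (l : ℕ) → Finset (ZMod l)) : Prop := ∀ l ∈ PP j, #(W l) ≤ 3 ∧ #(W l) < l

lemma dens_nonneg {j : ℕ} {W : (l : ℕ) → Finset (ZMod l)} (h : Adm j W) : 0 ≤ dens (PP j) W := by
  apply prod_nonneg
  intro l hl
  have h0 : (0:ℝ) < l := by exact_mod_cast (mem_pr.1 hl).1
  have h1 : (#(W l) : ℝ) ≤ l := by exact_mod_cast (h l hl).2.le
  rw [sub_nonneg, div_le_one h0]; exact h1

open Classical in
lemma SV {j : ℕ} (hj : 2 ≤ j) {W : (l : ℕ) → Finset (ZMod l)} (h : Adm j W) (X : ℕ)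
    (hX : 2^(2^j*220) ≤ X) :
    |(#{n ∈ range X | Sif (PP j) W n} : ℝ) - X * dens (PP j) W| ≤ (1/10^17) * X * dens (PP j) W := by
  have h1 := FL j hj (fun l => if l ∈ PP j then #(W l) else 0) (by
    intro l hl
    split_ifs with hl2
    · exact h l hl2
    · exact ⟨by norm_num, hl.pos⟩) 220 (by norm_num) W (by
    intro l hl
    have : l ∈ PP j := hl
    simp [this]) X hX
  have e1 : ∏ l ∈ pr 0 (2^(2^j)), (1 - ((if l ∈ PP j then #(W l) else 0 : ℕ) : ℝ)/l) = dens (PP j) W := by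
    unfold dens
    apply prod_congr rfl
    intro l hl
    have : l ∈ PP j := hl
    simp [this]
  rw [e1] at h1
  have e2 : cnt (pr 0 (2^(2^j))) W ∅ X = #{n ∈ range X | Sif (PP j) W n} := by
    unfold cnt
    congr 1
    ext n
    rw [mem_filter, mem_filter]
    simp [Sif, PP]
  rw [e2] at h1
  refine h1.trans ?_
  have := dens_nonneg h
  gcongr
  norm_num

open Classical in
lemma SVI {j : ℕ} (hj : 2 ≤ j) {W : (l : ℕ) → Finset (ZMod l)} (h : Adm j W) (α β : ℕ)
    (hX : 2^(2^j*220) ≤ α) (hab : α ≤ β) :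
    |(#{n ∈ Ioc α β | Sif (PP j) W n} : ℝ) - ((β:ℝ) - α) * dens (PP j) W|
      ≤ (1/10^17) * (α + β + 2) * dens (PP j) W := by
  have h1 := SV hj h (α+1) (by omega)
  have h2 := SV hj h (β+1) (by omega)
  have e : #{n ∈ range (β+1) | Sif (PP j) W n} = #{n ∈ range (α+1) | Sif (PP j) W n} + #{n ∈ Ioc α β | Sif (PP j) W n} := by
    rw [← card_union_of_disjoint]
    · congr 1
      ext n
      simp only [mem_filter, mem_range, mem_union, mem_Ioc]
      constructor
      · rintro ⟨a, b⟩
        by_cases hn : n < α + 1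
        · left; exact ⟨hn, b⟩
        · right; exact ⟨by omega, b⟩
      · rintro (⟨a, b⟩ | ⟨a, b⟩)
        · exact ⟨by omega, b⟩
        · exact ⟨by omega, b⟩
    · rw [disjoint_left]
      intro n hn hn2
      simp only [mem_filter, mem_range, mem_Ioc] at hn hn2
      omega
  have e' : (#{n ∈ range (β+1) | Sif (PP j) W n} : ℝ) = #{n ∈ range (α+1) | Sif (PP j) W n} + #{n ∈ Ioc α β | Sif (PP j) W n} := by
    exact_mod_cast e
  rw [e'] at h2
  push_cast at h1 h2
  rw [abs_le] at *
  constructor <;> nlinarith [h1.1, h1.2, h2.1, h2.2]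

open Classical in
lemma SVAP {j : ℕ} (hj : 2 ≤ j) {W : (l : ℕ) → Finset (ZMod l)} (h : Adm j W) (X l₀ e r : ℕ)
    (hl₀ : l₀ ∈ PP j) (hW : #(W l₀) = 1) (hX : 2^(2^j*220) * l₀^e ≤ X) (hr : r < l₀^e) :
    (#{n ∈ range X | Sif (PP j) W n ∧ n % l₀^e = r} : ℝ) ≤ 5 * (X / (l₀:ℝ)^e) * dens (PP j) W := by
  set q := l₀^e with hq
  have hlp : l₀.Prime := (mem_pr.1 hl₀).2.2
  have hq0 : 0 < q := by rw [hq]; exact pow_pos hlp.pos _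
  let W' : (l : ℕ) → Finset (ZMod l) := fun l => if l = l₀ then ∅ else shift W r q l
  have hcop : ∀ l ∈ PP j, l ≠ l₀ → Nat.Coprime q l := by
    intro l hl hne
    rw [hq]
    apply Nat.Coprime.pow_left
    exact (Nat.coprime_primes hlp (mem_pr.1 hl).2.2).2 (Ne.symm hne)
  have hc : ∀ l ∈ PP j, l ≠ l₀ → #(W' l) = #(W l) := by
    intro l hl hne
    simp only [W', hne, if_false]
    exact card_shift W r q l (hcop l hl hne)
  have hc0 : #(W' l₀) = 0 := by simp [W']
  have hA : Adm j W' := by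
    intro l hl
    by_cases hne : l = l₀
    · subst hne; rw [hc0]; exact ⟨by norm_num, hlp.pos⟩
    · rw [hc l hl hne]; exact h l hl
  have hXq : 2^(2^j*220) ≤ X/q := (Nat.le_div_iff_mul_le hq0).2 hX
  have hs := SV hj hA (X/q+1) (by omega)
  have hd : dens (PP j) W' ≤ 2 * dens (PP j) W := by
    unfold dens
    rw [← mul_prod_erase _ _ hl₀, ← mul_prod_erase _ (fun l => (1 - (#(W l) : ℝ) / l)) hl₀]
    have e1 : ∏ x ∈ (PP j).erase l₀, (1 - (#(W' x) : ℝ) / x) = ∏ x ∈ (PP j).erase l₀, (1 - (#(W x) : ℝ) / x) := by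
      apply prod_congr rfl
      intro l hl
      rw [mem_erase] at hl
      rw [hc l hl.2 hl.1]
    rw [e1, hc0, hW]
    have h0 : 0 ≤ ∏ x ∈ (PP j).erase l₀, (1 - (#(W x) : ℝ) / x) := by
      apply prod_nonneg
      intro l hl
      rw [mem_erase] at hl
      have h0 : (0:ℝ) < l := by exact_mod_cast (mem_pr.1 hl.2).1
      have h1 : (#(W l) : ℝ) ≤ l := by exact_mod_cast (h l hl.2).2.le
      rw [sub_nonneg, div_le_one h0]; exact h1
    have h2 : (2:ℝ) ≤ l₀ := by exact_mod_cast hlp.two_le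
    have h3 : (1:ℝ)/l₀ ≤ 1/2 := one_div_le_one_div_of_le (by norm_num) h2
    push_cast
    rw [zero_div, ← mul_assoc]
    apply mul_le_mul_of_nonneg_right _ h0
    linarith
  have hle : #{n ∈ range X | Sif (PP j) W n ∧ n % q = r} ≤ #{n ∈ range (X/q+1) | Sif (PP j) W' n} := by
    apply card_le_card_of_injOn (fun n => n / q)
    · intro n hn
      simp only [coe_filter, mem_range, Set.mem_ofPred_eq] at hn ⊢
      obtain ⟨h1, h2, h3⟩ := hn
      refine ⟨Nat.lt_succ_of_le (Nat.div_le_div_right h1.le), ?_⟩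
      intro l hl
      by_cases hne : l = l₀
      · subst hne; simp [W']
      · simp only [W', hne, if_false]
        rw [mem_shift W r q l _ (hcop l hl hne)]
        have : r + q * (n/q) = n := by rw [← h3]; exact Nat.mod_add_div n q
        rw [this]; exact h2 l hl
    · intro n hn m hm e
      simp only [coe_filter, mem_range, Set.mem_ofPred_eq] at hn hm e
      have e1 := Nat.mod_add_div n q
      have e2 := Nat.mod_add_div m q
      rw [← e1, ← e2, e, hn.2.2, hm.2.2]
  have hle' : (#{n ∈ range X | Sif (PP j) W n ∧ n % q = r} : ℝ) ≤ #{n ∈ range (X/q+1) | Sif (PP j) W' n} := by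
    exact_mod_cast hle
  refine hle'.trans ?_
  have h5 := (abs_le.1 hs).2
  have hD0 := dens_nonneg hA
  have hXr : (((X/q+1 : ℕ)):ℝ) ≤ 2 * (X/(q:ℝ)) := by
    push_cast
    have a1 : ((X/q : ℕ):ℝ) ≤ X/(q:ℝ) := Nat.cast_div_le
    have a2 : 1 ≤ X/q := le_trans Nat.one_le_two_pow hXq
    have a3 : (1:ℝ) ≤ ((X/q:ℕ):ℝ) := by exact_mod_cast a2
    linarith
  have e3 : (l₀:ℝ)^e = q := by rw [hq]; push_cast; rfl
  rw [e3]
  have hx0 : (0:ℝ) ≤ X/(q:ℝ) := by positivity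
  calc (#{n ∈ range (X/q+1) | Sif (PP j) W' n} : ℝ) ≤ (1+1/10^17) * (((X/q+1 : ℕ)):ℝ) * dens (PP j) W' := by linarith
    _ ≤ (1+1/10^17) * (2 * (X/(q:ℝ))) * (2 * dens (PP j) W) := by gcongr
    _ ≤ _ := by nlinarith [mul_nonneg hx0 (dens_nonneg h)]

end CW

namespace CW
open Finset

/-- The medium primes. -/
def LL (N j : ℕ) : Finset ℕ := {l ∈ pr (2^128) (2^(2^j)) | ¬ l ∣ N}

lemma mem_LL {N j l : ℕ} : l ∈ LL N j ↔ 2^128 < l ∧ l ≤ 2^(2^j) ∧ l.Prime ∧ ¬ l ∣ N := by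
  simp [LL, mem_pr, and_assoc]

lemma LL_sub {N j j' : ℕ} (h : j ≤ j') : LL N j ⊆ PP j' := by
  intro l hl
  rw [mem_LL] at hl
  refine mem_pr.2 ⟨hl.2.2.1.pos, hl.2.1.trans ?_, hl.2.2.1⟩
  exact Nat.pow_le_pow_right (by norm_num) (Nat.pow_le_pow_right (by norm_num) h)

def Wc (N j : ℕ) (S : Finset ℕ) (l : ℕ) : Finset (ZMod l) :=
  insert 0 (if l ∈ LL N j then S.image (fun p : ℕ => (N:ZMod l) * (p:ZMod l)⁻¹) else ∅)

noncomputable def Pi1 (j : ℕ) : ℝ := ∏ l ∈ PP j, (1 - 1/(l:ℝ))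

noncomputable def V (N j : ℕ) : ℝ := ∏ l ∈ LL N j, (1 - 1/((l:ℝ)-1))

def Rough (j n : ℕ) : Prop := ∀ l ∈ PP j, ¬ l ∣ n

def FF (N j n : ℕ) : Prop := ∀ l ∈ LL N j, (n : ZMod l) ≠ (N : ZMod l)

def Cop (N j : ℕ) (S : Finset ℕ) : Prop := ∀ p ∈ S, ∀ l ∈ LL N j, ¬ l ∣ p

noncomputable def hh (N j p₁ p₂ : ℕ) : ℝ :=
  ∏ l ∈ LL N j with (p₁ : ZMod l) = (p₂ : ZMod l), (1 + 1/((l:ℝ)-2))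

lemma unit_of {l p : ℕ} (hl : l.Prime) (h : ¬ l ∣ p) : (p : ZMod l) * (p:ZMod l)⁻¹ = 1 :=
  ZMod.coe_mul_inv_eq_one p ((Nat.Prime.coprime_iff_not_dvd hl).2 h).symm

set_option linter.constructorNameAsVariable false in
lemma sif_iff {N j j' : ℕ} (hj : j ≤ j') {S : Finset ℕ} (hS : Cop N j S) (n : ℕ) :
    Sif (PP j') (Wc N j S) n ↔ Rough j' n ∧ ∀ p ∈ S, FF N j (n*p) := by
  constructor
  · intro h
    constructor
    · intro l hl hd
      have := h l hl
      rw [← ZMod.natCast_eq_zero_iff] at hd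
      rw [hd] at this
      simp [Wc] at this
    · intro p hp l hl e
      have := h l (LL_sub hj hl)
      apply this
      unfold Wc
      rw [if_pos hl, mem_insert, mem_image]
      right
      refine ⟨p, hp, ?_⟩
      have hu := unit_of (mem_LL.1 hl).2.2.1 (hS p hp l hl)
      rw [← e]; push_cast
      linear_combination (n : ZMod l) * hu
  · rintro ⟨h1, h2⟩ l hl hm
    unfold Wc at hm
    rw [mem_insert] at hm
    rcases hm with hm | hm
    · exact h1 l hl ((ZMod.natCast_eq_zero_iff _ _).1 hm)
    · split_ifs at hm with hL
      · rw [mem_image] at hm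
        obtain ⟨p, hp, e⟩ := hm
        apply h2 p hp l hL
        have hu := unit_of (mem_LL.1 hL).2.2.1 (hS p hp l hL)
        push_cast; rw [← e]
        linear_combination (N : ZMod l) * hu
      · simp at hm

lemma card_Wc {N j : ℕ} {S : Finset ℕ} (hS : Cop N j S) {l : ℕ} (hl : l ∈ LL N j) :
    #(Wc N j S l) = 1 + #(S.image (fun p : ℕ => (p : ZMod l))) := by
  have hlp := (mem_LL.1 hl).2.2.1
  have : Fact l.Prime := ⟨hlp⟩
  have hN : (N : ZMod l) ≠ 0 := by
    rw [Ne, ZMod.natCast_eq_zero_iff]; exact (mem_LL.1 hl).2.2.2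
  unfold Wc
  rw [if_pos hl, card_insert_of_notMem, add_comm]
  · congr 1
    have : S.image (fun p : ℕ => (N:ZMod l) * (p:ZMod l)⁻¹) = (S.image (fun p : ℕ => (p : ZMod l))).image (fun x => (N:ZMod l) * x⁻¹) := by
      rw [image_image]; rfl
    rw [this]
    apply card_image_of_injective
    intro x y e
    exact inv_injective (mul_left_cancel₀ hN e)
  · rw [mem_image]
    rintro ⟨p, hp, e⟩
    have hp0 : (p : ZMod l) ≠ 0 := by
      rw [Ne, ZMod.natCast_eq_zero_iff]; exact hS p hp l hl
    exact mul_ne_zero hN (inv_ne_zero hp0) e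

lemma card_Wc' {N j : ℕ} {S : Finset ℕ} {l : ℕ} (hl : l ∉ LL N j) :
    #(Wc N j S l) = 1 := by
  simp [Wc, hl]

lemma adm_Wc {N j j' : ℕ} {S : Finset ℕ} (hS : Cop N j S) (h2 : #S ≤ 2) : Adm j' (Wc N j S) := by
  intro l hl
  have hp := (mem_pr.1 hl).2.2
  by_cases h : l ∈ LL N j
  · rw [card_Wc hS h]
    have h3 : #(S.image (fun p : ℕ => (p : ZMod l))) ≤ #S := card_image_le
    have := (mem_LL.1 h).1
    constructor
    · omega
    · have : 3 < 2^128 := by norm_num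
      omega
  · rw [card_Wc' h]
    exact ⟨by norm_num, hp.one_lt⟩

lemma dens_Wc {N j j' : ℕ} (hj : j ≤ j') {S : Finset ℕ} (hS : Cop N j S) :
    dens (PP j') (Wc N j S) = Pi1 j' * ∏ l ∈ LL N j, (1 - (#(S.image (fun p : ℕ => (p : ZMod l))):ℝ)/((l:ℝ)-1)) := by
  unfold dens Pi1
  have e : ∏ l ∈ LL N j, (1 - (#(S.image (fun p : ℕ => (p : ZMod l))):ℝ)/((l:ℝ)-1)) =
    ∏ l ∈ PP j', (if l ∈ LL N j then (1 - (#(S.image (fun p : ℕ => (p : ZMod l))):ℝ)/((l:ℝ)-1)) else 1) := by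
    rw [prod_ite_mem, inter_eq_right.2 (LL_sub hj)]
  rw [e, ← prod_mul_distrib]
  apply prod_congr rfl
  intro l hl
  split_ifs with h
  · rw [card_Wc hS h]
    have h2 : (2:ℝ) ≤ l := by exact_mod_cast (mem_pr.1 hl).2.2.two_le
    have h3 : (l:ℝ) - 1 ≠ 0 := by linarith
    have h4 : (l:ℝ) ≠ 0 := by linarith
    push_cast
    field_simp
    ring
  · rw [card_Wc' h]; simp

lemma cop_empty {N j : ℕ} : Cop N j ∅ := by intro p hp; simp at hp

lemma dens_empty {N j j' : ℕ} (hj : j ≤ j') : dens (PP j') (Wc N j ∅) = Pi1 j' := by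
  rw [dens_Wc hj cop_empty]; simp

lemma dens_one {N j j' : ℕ} (hj : j ≤ j') {p : ℕ} (hS : Cop N j {p}) :
    dens (PP j') (Wc N j {p}) = Pi1 j' * V N j := by
  rw [dens_Wc hj hS]; simp [V]

lemma LL_big {N j l : ℕ} (h : l ∈ LL N j) : (2:ℝ)^128 ≤ l := by
  exact_mod_cast (mem_LL.1 h).1.le

lemma Pi1_nonneg (j : ℕ) : 0 ≤ Pi1 j := by
  apply prod_nonneg
  intro l hl
  have h2 : (1:ℝ) ≤ l := by exact_mod_cast (mem_pr.1 hl).1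
  rw [sub_nonneg, div_le_one (by linarith)]; exact h2

lemma V_nonneg (N j : ℕ) : 0 ≤ V N j := by
  apply prod_nonneg
  intro l hl
  have := LL_big hl
  have h2 : (2:ℝ) ≤ l := le_trans (by norm_num) this
  rw [sub_nonneg, div_le_one (by linarith)]; linarith

lemma V_le_one (N j : ℕ) : V N j ≤ 1 := by
  apply prod_le_one
  · intro l hl
    have := LL_big hl
    have h2 : (2:ℝ) ≤ l := le_trans (by norm_num) this
    rw [sub_nonneg, div_le_one (by linarith)]; linarith
  · intro l hl
    have := LL_big hl
    have h2 : (2:ℝ) ≤ l := le_trans (by norm_num) this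
    have : 0 ≤ 1/((l:ℝ)-1) := by apply div_nonneg <;> linarith
    linarith

lemma dens_two {N j j' : ℕ} (hj : j ≤ j') {p q : ℕ} (hS : Cop N j {p, q}) :
    dens (PP j') (Wc N j {p, q}) ≤ Pi1 j' * (V N j^2 * hh N j p q) := by
  rw [dens_Wc hj hS]
  apply mul_le_mul_of_nonneg_left _ (Pi1_nonneg _)
  unfold V hh
  rw [prod_filter, ← prod_pow, ← prod_mul_distrib]
  apply prod_le_prod
  · intro l hl
    have h1 := LL_big hl
    have h2 : (4:ℝ) ≤ l := le_trans (by norm_num) h1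
    have h3 : #(({p,q}:Finset ℕ).image (fun p : ℕ => (p : ZMod l))) ≤ 2 := card_image_le.trans card_le_two
    have h4 : (#(({p,q}:Finset ℕ).image (fun p : ℕ => (p : ZMod l))) : ℝ) ≤ 2 := by exact_mod_cast h3
    rw [sub_nonneg, div_le_one (by linarith)]; linarith
  · intro l hl
    have h1 := LL_big hl
    have h2 : (4:ℝ) ≤ l := le_trans (by norm_num) h1
    have h3 : (l:ℝ) - 1 ≠ 0 := by linarith
    have h4 : (l:ℝ) - 2 ≠ 0 := by linarith
    rw [image_insert, image_singleton]
    split_ifs with h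
    · rw [h]
      simp only [mem_singleton, insert_eq_of_mem, card_singleton, Nat.cast_one]
      apply le_of_eq
      field_simp
      ring
    · rw [card_pair h]
      push_cast
      have : (1 - 1/((l:ℝ)-1))^2*1 - (1 - 2/((l:ℝ)-1)) = (1/((l:ℝ)-1))^2 := by ring
      nlinarith [sq_nonneg (1/((l:ℝ)-1))]

lemma one_le_hh (N j p q : ℕ) : 1 ≤ hh N j p q := by
  unfold hh
  refine le_trans (le_of_eq (prod_const_one (s := {l ∈ LL N j | (p : ZMod l) = (q : ZMod l)})).symm) ?_
  apply prod_le_prod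
  · intros; norm_num
  · intro l hl
    have h1 := LL_big (mem_filter.1 hl).1
    have h2 : (4:ℝ) ≤ l := le_trans (by norm_num) h1
    have : 0 ≤ 1/((l:ℝ)-2) := by apply div_nonneg <;> linarith
    linarith

lemma Pi1_le (j : ℕ) : Pi1 j * ((2:ℝ)^j * Real.log 2) ≤ 1 := by
  set z := 2^(2^j) with hz
  let f : ℕ →* ℝ :=
    { toFun := fun n => (n:ℝ)⁻¹
      map_one' := by simp
      map_mul' := by intro x y; push_cast; rw [mul_inv] }
  have hf : ∀ n, f n = (n:ℝ)⁻¹ := fun n => rfl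
  have hS := EulerProduct.summable_and_hasSum_smoothNumbers_prod_primesBelow_geometric (f := f) (by
    intro p hp
    rw [hf, norm_inv, Real.norm_natCast]
    apply inv_lt_one_of_one_lt₀
    exact_mod_cast hp.one_lt) (z+1)
  have e1 : ∏ p ∈ (z+1).primesBelow, (1 - f p)⁻¹ = (Pi1 j)⁻¹ := by
    unfold Pi1
    rw [← prod_inv_distrib]
    apply prod_congr
    · ext p
      simp only [Nat.mem_primesBelow, PP, mem_pr]
      constructor
      · rintro ⟨h1, h2⟩; exact ⟨h2.pos, by omega, h2⟩
      · rintro ⟨h1, h2, h3⟩; exact ⟨by omega, h3⟩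
    · intro p _; rw [hf, one_div]
  rw [e1] at hS
  have hlow : Real.log (z+1) ≤ (Pi1 j)⁻¹ := by
    have hz1 := log_add_one_le_harmonic z
    push_cast at hz1
    refine hz1.trans ?_
    have hm : ∀ i : Fin z, i.val + 1 ∈ (z+1).smoothNumbers := fun i =>
      Nat.mem_smoothNumbers_of_lt (by omega) (by omega)
    have := sum_le_hasSum (univ.map ⟨fun i : Fin z => (⟨i.val+1, hm i⟩ : (z+1).smoothNumbers), by
      intro a b h; simp only [Subtype.mk.injEq] at h; exact Fin.ext (by omega)⟩) (by
        intro i _; rw [hf]; positivity) hS.2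
    refine le_trans (le_of_eq ?_) this
    rw [sum_map]
    simp only [Function.Embedding.coeFn_mk, hf]
    rw [harmonic, ← Fin.sum_univ_eq_sum_range (fun i => ((i+1 : ℕ):ℚ)⁻¹)]
    push_cast
    apply sum_congr rfl
    intro i _
    congr 1
    show ((i:ℕ):ℝ) + 1 = (((i:ℕ)+1 : ℕ):ℝ)
    push_cast; rfl
  have hl : (2:ℝ)^j * Real.log 2 ≤ Real.log (z+1) := by
    have : (2:ℝ)^j * Real.log 2 = Real.log (z:ℝ) := by
      rw [hz]; push_cast; rw [Real.log_pow]; push_cast; rfl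
    rw [this]
    apply Real.log_le_log
    · rw [hz]; positivity
    · linarith
  have h0 := Pi1_nonneg j
  rcases h0.eq_or_lt with h | h
  · rw [← h]; simp
  · calc _ ≤ Pi1 j * (Pi1 j)⁻¹ := by gcongr; linarith
      _ = 1 := mul_inv_cancel₀ h.ne'

lemma prod_shift_lower (S : Finset ℕ) (c : ℕ) (z : ℕ) (hz : c ≤ z) (hc : 1 ≤ c) (hS : ∀ l ∈ S, c < l ∧ l ≤ z) :
    (c:ℝ)/z ≤ ∏ l ∈ S, (1 - 1/(l:ℝ)) := by
  have h1 : ∀ z, c ≤ z → ∏ l ∈ Ioc c z, (1 - 1/(l:ℝ)) = c/z := by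
    intro z hz
    induction z, hz using Nat.le_induction with
    | base => simp; rw [div_self]; positivity
    | succ n hn ih =>
      rw [← Finset.insert_Ioc_right_eq_Ioc_add_one hn, prod_insert (by simp), ih]
      have : (n:ℝ) ≠ 0 := by have : 0 < n := by omega
                             positivity
      push_cast
      field_simp
      ring
  rw [← h1 z hz]
  have hsub : S ⊆ Ioc c z := fun l hl => mem_Ioc.2 (hS l hl)
  have hf : ∀ l ∈ Ioc c z, 0 ≤ 1 - 1/(l:ℝ) ∧ 1 - 1/(l:ℝ) ≤ 1 := by
    intro l hl
    have : (1:ℝ) ≤ l := by have := (mem_Ioc.1 hl).1; exact_mod_cast (by omega : 1 ≤ l)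
    constructor
    · rw [sub_nonneg, div_le_one (by linarith)]; exact this
    · have : 0 ≤ 1/(l:ℝ) := by positivity
      linarith
  rw [← prod_sdiff hsub]
  calc _ ≤ 1 * ∏ l ∈ S, (1 - 1/(l:ℝ)) := by
        apply mul_le_mul_of_nonneg_right
        · apply prod_le_one
          · intro l hl; exact (hf l (mem_sdiff.1 hl).1).1
          · intro l hl; exact (hf l (mem_sdiff.1 hl).1).2
        · apply prod_nonneg; intro l hl; exact (hf l (hsub hl)).1
    _ = _ := one_mul _

lemma Pi1_ge (j : ℕ) : 1/(2:ℝ)^(2^j) ≤ Pi1 j := by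
  have := prod_shift_lower (PP j) 1 (2^(2^j)) Nat.one_le_two_pow le_rfl (by
    intro l hl; have := mem_pr.1 hl; exact ⟨this.2.2.one_lt, this.2.1⟩)
  push_cast at this; exact this

lemma V_ge (N j : ℕ) : 1/(2:ℝ)^(2^j) ≤ V N j := by
  have := prod_shift_lower ((LL N j).image (fun l => l - 1)) 1 (2^(2^j)) Nat.one_le_two_pow le_rfl (by
    intro l hl
    obtain ⟨m, hm, rfl⟩ := mem_image.1 hl
    have := mem_LL.1 hm
    have h2 : 2 < 2^128 := by norm_num
    have h3 := this.1
    have h4 := this.2.1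
    omega)
  rw [prod_image] at this
  · refine le_trans (le_of_eq (by push_cast; rfl)) (this.trans (le_of_eq ?_))
    unfold V
    apply prod_congr rfl
    intro l hl
    have := (mem_LL.1 hl).2.2.1.one_lt
    rw [Nat.cast_sub (by omega)]; simp
  · intro a ha b hb e
    have := (mem_LL.1 ha).2.2.1.one_lt
    have := (mem_LL.1 hb).2.2.1.one_lt
    simp only at e
    omega

end CW

namespace CW
open Finset

noncomputable def cc (l : ℕ) : ℝ := Real.sqrt l / (l * 2^62)

lemma cc_nonneg (l : ℕ) : 0 ≤ cc l := by unfold cc; positivity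

lemma tele_odd (S : Finset ℕ) (m₀ : ℕ) (hm : 2 ≤ m₀) (hS : ∀ l ∈ S, 2*m₀ < l ∧ l % 2 = 1) (n : ℕ)
    (hn : m₀ ≤ n) :
    (∏ l ∈ S with l < 2*n+1, (1 + 1/((l:ℝ)-2)))^2 ≤ ((n:ℝ)-1)/((m₀:ℝ)-1) := by
  have hm' : (2:ℝ) ≤ m₀ := by exact_mod_cast hm
  induction n, hn using Nat.le_induction with
  | base =>
    have : S.filter (fun l => l < 2*m₀+1) = ∅ := by
      rw [filter_eq_empty_iff]; intro l hl; have := hS l hl; omega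
    rw [this]; simp
    rw [div_self]; linarith
  | succ n hn ih =>
    have hn' : (2:ℝ) ≤ n := by exact_mod_cast hm.trans hn
    have h1 : (1 + 1/(((2*n+1:ℕ):ℝ)-2))^2 * ((n:ℝ)-1) ≤ n := by
      push_cast
      have e : (1 + 1/((2*(n:ℝ)+1)-2)) = 2*n/(2*n-1) := by
        have : (2*(n:ℝ)+1)-2 ≠ 0 := by linarith
        have : (2*(n:ℝ))-1 ≠ 0 := by linarith
        field_simp; ring
      rw [e, div_pow, div_mul_eq_mul_div, div_le_iff₀ (by apply pow_pos; linarith)]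
      nlinarith
    by_cases hmem : 2*n+1 ∈ S
    · have e : S.filter (fun l => l < 2*(n+1)+1) = insert (2*n+1) (S.filter (fun l => l < 2*n+1)) := by
        ext l; simp only [mem_filter, mem_insert]
        constructor
        · rintro ⟨a, b⟩
          have := (hS l a).2
          by_cases h : l = 2*n+1
          · left; exact h
          · right; exact ⟨a, by omega⟩
        · rintro (a | ⟨a, b⟩)
          · subst a; exact ⟨hmem, by omega⟩
          · exact ⟨a, by omega⟩
      rw [e, prod_insert (by simp), mul_pow]
      calc _ ≤ (1 + 1/(((2*n+1:ℕ):ℝ)-2))^2 * (((n:ℝ)-1)/((m₀:ℝ)-1)) := by gcongr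
        _ ≤ _ := by
          rw [← mul_div_assoc]
          apply div_le_div_of_nonneg_right _ (by linarith)
          push_cast at *; linarith
    · have e : S.filter (fun l => l < 2*(n+1)+1) = S.filter (fun l => l < 2*n+1) := by
        ext l; simp only [mem_filter]
        constructor
        · rintro ⟨a, b⟩
          have := (hS l a).2
          have : l ≠ 2*n+1 := fun h => hmem (h ▸ a)
          exact ⟨a, by omega⟩
        · rintro ⟨a, b⟩
          exact ⟨a, by omega⟩
      rw [e]
      refine ih.trans ?_
      apply div_le_div_of_nonneg_right _ (by linarith)
      push_cast; linarith

lemma LL_odd {N j l : ℕ} (h : l ∈ LL N j) : 2*2^127 < l ∧ l % 2 = 1 := by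
  have h1 := mem_LL.1 h
  have h2 : 2*2^127 = 2^128 := by norm_num
  refine ⟨by rw [h2]; exact h1.1, ?_⟩
  rcases h1.2.2.1.eq_two_or_odd with h | h
  · have : 2 < 2^128 := by norm_num
    have := h1.1
    omega
  · exact h

lemma aux_id (x s : ℝ) (hx : 0 < x) : 2/x*(s/2^63) = s/(x*2^62) := by
  rw [div_mul_div_comm, div_eq_div_iff (by positivity) (by positivity)]
  ring

lemma hh_le (N j p q : ℕ) : hh N j p q - 1 ≤ ∑ l ∈ LL N j with (p : ZMod l) = (q : ZMod l), cc l := by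
  unfold hh
  set S := {l ∈ LL N j | (p : ZMod l) = (q : ZMod l)} with hSdef
  have hS : ∀ l ∈ S, l ∈ LL N j := fun l hl => (mem_filter.1 hl).1
  have := Finset.prod_add_ordered S (fun _ => (1:ℝ)) (fun l => 1/((l:ℝ)-2))
  rw [this]
  simp only [prod_const_one, mul_one]
  rw [add_sub_cancel_left]
  apply sum_le_sum
  intro l hl
  obtain ⟨n, hn⟩ : ∃ n, l = 2*n+1 := ⟨l/2, by have := (LL_odd (hS l hl)).2; omega⟩
  have hlw := (LL_odd (hS l hl)).1
  have hT := tele_odd S (2^127) (by norm_num) (fun l hl => LL_odd (hS l hl)) n (by omega)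
  rw [← hn] at hT
  have hl2 := LL_big (hS l hl)
  have hl4 : (4:ℝ) ≤ l := le_trans (by norm_num) hl2
  have h0 : 0 ≤ (∏ l' ∈ S with l' < l, (1 + 1/((l':ℝ)-2))) := by
    apply prod_nonneg
    intro i hi
    have h1 := LL_big (hS i (mem_filter.1 hi).1)
    have h2 : (4:ℝ) ≤ i := le_trans (by norm_num) h1
    have : 0 ≤ 1/((i:ℝ)-2) := by apply div_nonneg <;> linarith
    linarith
  have hH : (∏ l' ∈ S with l' < l, (1 + 1/((l':ℝ)-2))) ≤ Real.sqrt l / 2^63 := by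
    refine (pow_le_pow_iff_left₀ h0 (by positivity) two_ne_zero).1 ?_
    · rw [div_pow, Real.sq_sqrt (by linarith)]
      refine hT.trans ?_
      have : (l:ℝ) = 2*n+1 := by rw [hn]; push_cast; ring
      rw [this]
      have h0 : (0:ℝ) ≤ n := Nat.cast_nonneg n
      push_cast
      rw [div_le_div_iff₀ (by norm_num) (by norm_num)]
      norm_num
      nlinarith
  unfold cc
  have hthis : 1/((l:ℝ)-2) ≤ 2/l := by
    rw [div_le_div_iff₀ (by linarith) (by linarith)]; linarith
  have h2l : (0:ℝ) ≤ 2/l := div_nonneg zero_le_two (by linarith)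
  have hfin := mul_le_mul hthis hH h0 h2l
  refine hfin.trans (le_of_eq ?_)
  exact aux_id l (Real.sqrt l) (by linarith)

lemma sum_sqrt (w : ℕ) (hw : 1 ≤ w) (z : ℕ) (hz : w ≤ z) :
    ∑ n ∈ Ioc w z, Real.sqrt n / (n:ℝ)^2 ≤ 2/Real.sqrt w - 2/Real.sqrt z := by
  induction z, hz using Nat.le_induction with
  | base => simp
  | succ n hn ih =>
    rw [← Finset.insert_Ioc_right_eq_Ioc_add_one hn, sum_insert (by simp)]
    set s := Real.sqrt ((n+1:ℕ):ℝ) with hs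
    set t := Real.sqrt (n:ℝ) with ht
    have hn1 : (1:ℝ) ≤ n := by exact_mod_cast hw.trans hn
    have s2 : s^2 = n+1 := by rw [hs, Real.sq_sqrt (by positivity)]; push_cast; ring
    have t2 : t^2 = n := by rw [ht, Real.sq_sqrt (by positivity)]
    have s0 : 0 < s := by rw [hs]; positivity
    have t0 : 0 < t := by rw [ht]; positivity
    have hts : t ≤ s := by rw [hs, ht]; apply Real.sqrt_le_sqrt; push_cast; linarith
    have e1 : ((n+1:ℕ):ℝ) = s^2 := by rw [s2]; push_cast; ring
    rw [e1]
    have key : s/(s^2)^2 ≤ 2/t - 2/s := by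
      have : 2/t - 2/s = 2*(s-t)/(t*s) := by field_simp
      rw [this, div_le_div_iff₀ (by positivity) (by positivity)]
      have h1 : (s-t)*(s+t) = 1 := by nlinarith
      have h3 : s - t = 1/(s+t) := by rw [eq_div_iff (by positivity)]; exact h1
      rw [h3, show 2*(1/(s+t))*(s^2)^2 = 2*(s^2)^2/(s+t) by ring, le_div_iff₀ (by positivity)]
      have h4 : t*(s+t) ≤ s*(s+s) := by gcongr
      calc s*(t*s)*(s+t) = s^2*(t*(s+t)) := by ring
        _ ≤ s^2*(s*(s+s)) := by gcongr
        _ = _ := by ring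
    linarith

lemma sum_cc (N j : ℕ) (hj : 7 ≤ j) : ∑ l ∈ LL N j, cc l / l ≤ 1/2^125 := by
  have h1 : ∑ l ∈ LL N j, cc l / l ≤ ∑ n ∈ Ioc ((2:ℕ)^128) (2^(2^j)), (Real.sqrt (n:ℕ) / ((n:ℕ):ℝ)^2)/2^62 := by
    apply (sum_le_sum_of_subset_of_nonneg (t := Ioc ((2:ℕ)^128) (2^(2^j))) _ _).trans (sum_le_sum _)
    · intro l hl; have := mem_LL.1 hl; exact mem_Ioc.2 ⟨this.1, this.2.1⟩
    · intro l _ _; have := cc_nonneg l; positivity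
    · intro l hl
      apply le_of_eq
      unfold cc
      rw [div_div, div_div]; congr 1; ring
  refine h1.trans ?_
  rw [← sum_div]
  have hz : 2^128 ≤ 2^(2^j) := by
    apply Nat.pow_le_pow_right (by norm_num)
    calc 128 = 2^7 := by norm_num
      _ ≤ 2^j := Nat.pow_le_pow_right (by norm_num) hj
  have h2 := sum_sqrt (2^128) (by norm_num) (2^(2^j)) hz
  have e : Real.sqrt ((2^128:ℕ):ℝ) = 2^64 := by
    rw [show ((2^128:ℕ):ℝ) = ((2:ℝ)^64)^2 by norm_num, Real.sqrt_sq (by positivity)]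
  rw [e] at h2
  have h3 : 0 ≤ 2/Real.sqrt ((2^(2^j):ℕ):ℝ) := by positivity
  calc _ ≤ (2/2^64)/(2:ℝ)^62 := by gcongr; linarith
    _ = _ := by norm_num

end CW

namespace CW
open Finset

open Classical in
noncomputable def fI (N j n : ℕ) : ℝ := if FF N j n then 1 else 0

open Classical in
noncomputable def rI (j n : ℕ) : ℝ := if Rough j n then 1 else 0

lemma fI_nonneg (N j n : ℕ) : 0 ≤ fI N j n := by unfold fI; split_ifs <;> norm_num
lemma fI_le (N j n : ℕ) : fI N j n ≤ 1 := by unfold fI; split_ifs <;> norm_num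
lemma rI_nonneg (j n : ℕ) : 0 ≤ rI j n := by unfold rI; split_ifs <;> norm_num
lemma rI_le (j n : ℕ) : rI j n ≤ 1 := by unfold rI; split_ifs <;> norm_num

open Classical in
lemma sum_eq_card {N j j' : ℕ} (hj : j ≤ j') {S : Finset ℕ} (hS : Cop N j S) (I : Finset ℕ) :
    ∑ k ∈ I, rI j' k * ∏ p ∈ S, fI N j (k*p) = #{k ∈ I | Sif (PP j') (Wc N j S) k} := by
  rw [card_filter]
  push_cast
  apply sum_congr rfl
  intro k _
  have : ∏ p ∈ S, fI N j (k*p) = if ∀ p ∈ S, FF N j (k*p) then 1 else 0 := by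
    unfold fI
    rw [prod_ite_zero]; simp
  rw [this, rI]
  by_cases h1 : Rough j' k <;> by_cases h2 : ∀ p ∈ S, FF N j (k*p)
  · rw [if_pos h1, if_pos h2, if_pos ((sif_iff hj hS k).2 ⟨h1, h2⟩)]; norm_num
  · rw [if_pos h1, if_neg h2, if_neg (fun h => h2 ((sif_iff hj hS k).1 h).2)]; norm_num
  · rw [if_neg h1, if_neg (fun h => h1 ((sif_iff hj hS k).1 h).1)]; norm_num
  · rw [if_neg h1, if_neg (fun h => h1 ((sif_iff hj hS k).1 h).1)]; norm_num

lemma CSI {N j j' : ℕ} (hj2 : 2 ≤ j') (hj : j ≤ j') {S : Finset ℕ} (hS : Cop N j S) (h2 : #S ≤ 2)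
    (α β : ℕ) (hX : 2^(2^j'*220) ≤ α) (hab : α ≤ β) :
    |∑ k ∈ Ioc α β, rI j' k * ∏ p ∈ S, fI N j (k*p) - ((β:ℝ) - α) * dens (PP j') (Wc N j S)|
      ≤ (1/10^17) * (α + β + 2) * dens (PP j') (Wc N j S) := by
  rw [sum_eq_card hj hS]
  exact SVI hj2 (adm_Wc hS h2) α β hX hab

lemma inner_pair {N j : ℕ} (hj2 : 2 ≤ j) {p q : ℕ} (hpq : p ≠ q) (hp : Cop N j {p}) (hq : Cop N j {q})
    (M α β : ℕ) (hM : 2^(2^j*220) ≤ M) (h1 : M ≤ α) (h2 : α ≤ β) (h3 : β ≤ 2*M) :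
    ∑ k ∈ Ioc α β, rI j k * ((fI N j (k*p) - V N j) * (fI N j (k*q) - V N j)) ≤
      Pi1 j * V N j^2 * M * (2 * (hh N j p q - 1) + 24/10^17) := by
  have hpq' : Cop N j {p, q} := by
    intro r hr
    rw [mem_insert, mem_singleton] at hr
    rcases hr with rfl | rfl
    · exact hp _ (mem_singleton_self _)
    · exact hq _ (mem_singleton_self _)
  have hα : 2^(2^j*220) ≤ α := hM.trans h1
  have a0 := CSI hj2 le_rfl (N := N) (j := j) cop_empty (by simp) α β hα h2
  have a1 := CSI hj2 le_rfl hp (by simp) α β hα h2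
  have a2 := CSI hj2 le_rfl hq (by simp) α β hα h2
  have a3 := CSI hj2 le_rfl hpq' card_le_two α β hα h2
  have d3 := dens_two le_rfl hpq'
  have d30 := dens_nonneg (adm_Wc hpq' card_le_two (j' := j))
  rw [dens_empty le_rfl] at a0
  rw [dens_one le_rfl hp] at a1
  rw [dens_one le_rfl hq] at a2
  simp only [prod_empty, mul_one, prod_singleton] at a0 a1 a2
  simp only [prod_pair hpq] at a3
  have e : ∑ k ∈ Ioc α β, rI j k * ((fI N j (k*p) - V N j) * (fI N j (k*q) - V N j)) =
      ∑ k ∈ Ioc α β, rI j k * (fI N j (k*p) * fI N j (k*q))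
      - V N j * ∑ k ∈ Ioc α β, rI j k * fI N j (k*p)
      - V N j * ∑ k ∈ Ioc α β, rI j k * fI N j (k*q)
      + V N j^2 * ∑ k ∈ Ioc α β, rI j k := by
    rw [mul_sum, mul_sum, mul_sum, ← sum_sub_distrib, ← sum_sub_distrib, ← sum_add_distrib]
    apply sum_congr rfl
    intro k _; ring
  rw [e]
  generalize ∑ k ∈ Ioc α β, rI j k * (fI N j (k*p) * fI N j (k*q)) = A3 at *
  generalize ∑ k ∈ Ioc α β, rI j k * fI N j (k*p) = A1 at *
  generalize ∑ k ∈ Ioc α β, rI j k * fI N j (k*q) = A2 at *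
  generalize ∑ k ∈ Ioc α β, rI j k = A0 at *
  have hP := Pi1_nonneg j
  have hV := V_nonneg N j
  have hh1 := one_le_hh N j p q
  generalize hh N j p q = h at *
  generalize Pi1 j = P at *
  generalize V N j = v at *
  generalize dens (PP j) (Wc N j {p, q}) = D at *
  have hM1 : (1:ℝ) ≤ M := by
    have : 1 ≤ M := le_trans Nat.one_le_two_pow hM
    exact_mod_cast this
  have b1 : (M:ℝ) ≤ α := by exact_mod_cast h1
  have b2 : (α:ℝ) ≤ β := by exact_mod_cast h2
  have b3 : (β:ℝ) ≤ 2*M := by exact_mod_cast h3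
  clear e hM hα h1 h2 h3 hp hq hpq' hpq
  generalize (M:ℝ) = m at *
  generalize (α:ℝ) = x at *
  generalize (β:ℝ) = y at *
  set E := 1/(10:ℝ)^17 * (x+y+2) with hE
  have hE0 : 0 ≤ E := by rw [hE]; apply mul_nonneg; norm_num; linarith
  have hE6 : E ≤ 1/(10:ℝ)^17 * (6*m) := by rw [hE]; gcongr; linarith
  have c0 := (abs_le.1 a0).2
  have c1 := (abs_le.1 a1).1
  have c2 := (abs_le.1 a2).1
  have c3 := (abs_le.1 a3).2
  have Pv : 0 ≤ P * v^2 := by positivity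
  have k3 : A3 ≤ (y - x + E) * (P * (v^2*h)) := by
    calc A3 ≤ (y-x+E) * D := by linarith
      _ ≤ _ := by apply mul_le_mul_of_nonneg_left d3; linarith
  have k1 : v * A1 ≥ (y - x - E) * (P * v^2) := by
    have : (y-x-E) * (P*v) ≤ A1 := by linarith
    nlinarith
  have k2 : v * A2 ≥ (y - x - E) * (P * v^2) := by
    have : (y-x-E) * (P*v) ≤ A2 := by linarith
    nlinarith
  have k0 : v^2 * A0 ≤ (y - x + E) * (P * v^2) := by
    have : A0 ≤ (y-x+E) * P := by linarith
    nlinarith [sq_nonneg v]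
  calc A3 - v*A1 - v*A2 + v^2*A0 ≤ (P * v^2) * ((y-x)*(h-1) + E*(h+3)) := by nlinarith
    _ ≤ (P*v^2) * (m * (h-1) + 1/(10:ℝ)^17 * (6*m)*(h+3)) := by
        apply mul_le_mul_of_nonneg_left _ Pv
        have : (y-x)*(h-1) ≤ m*(h-1) := by apply mul_le_mul_of_nonneg_right <;> linarith
        have : E*(h+3) ≤ 1/(10:ℝ)^17 * (6*m)*(h+3) := by apply mul_le_mul_of_nonneg_right <;> linarith
        linarith
    _ ≤ (P*v^2) * (m * (2*(h-1) + 24/10^17)) := by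
        apply mul_le_mul_of_nonneg_left _ Pv
        have : 0 ≤ m * (h-1) := mul_nonneg (by linarith) (by linarith)
        nlinarith
    _ = _ := by ring

end CW

namespace CW
open Finset

def Hyp (N j : ℕ) : Prop := 25 ≤ j ∧ 2^(2^j*2^16) ≤ N ∧ N < 2^(2^j*2^17)

def yy (j : ℕ) : ℕ := 2^(2^(j+8))

lemma yy_eq (j : ℕ) : yy j = 2^(2^j*256) := by unfold yy; rw [pow_add]; norm_num

lemma z_le_yy (j : ℕ) : 2^(2^j) ≤ yy j := by
  rw [yy_eq]; apply Nat.pow_le_pow_right (by norm_num); omega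

attribute [irreducible] yy

def wt (N k p : ℕ) : ℝ := if N < 4*(k*p) ∧ k*p ≤ N then 1 else 0

lemma wt_nonneg (N k p : ℕ) : 0 ≤ wt N k p := by unfold wt; split_ifs <;> norm_num
lemma wt_le (N k p : ℕ) : wt N k p ≤ 1 := by unfold wt; split_ifs <;> norm_num

lemma cop_prime {N j p : ℕ} (hp : p.Prime) (h : 2^(2^j) < p) : Cop N j {p} := by
  intro q hq l hl hd
  rw [mem_singleton] at hq; subst hq
  have h1 := mem_LL.1 hl
  have := (Nat.prime_dvd_prime_iff_eq h1.2.2.1 hp).1 hd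
  omega

lemma rough_prime {j p : ℕ} (hp : p.Prime) (h : 2^(2^j) < p) : Rough j p := by
  intro l hl hd
  have h1 := mem_pr.1 hl
  have := (Nat.prime_dvd_prime_iff_eq h1.2.2 hp).1 hd
  omega

lemma wt_prod (N M p q k : ℕ) (hp : 0 < p) (hq : 0 < q) (hk : k ∈ Ioc M (2*M)) :
    wt N k p * wt N k q =
      if k ∈ Ioc (max M (max (N/(4*p)) (N/(4*q)))) (min (2*M) (min (N/p) (N/q))) then 1 else 0 := by
  have f1 : ∀ p, 0 < p → (N < 4*(k*p) ↔ N/(4*p) < k) := by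
    intro p hp
    rw [Nat.div_lt_iff_lt_mul (by omega)]
    constructor <;> intro h <;> nlinarith
  have f2 : ∀ p, 0 < p → (k*p ≤ N ↔ k ≤ N/p) := by
    intro p hp
    rw [Nat.le_div_iff_mul_le hp]
  unfold wt
  simp only [f1 p hp, f1 q hq, f2 p hp, f2 q hq, mem_Ioc] at *
  rw [ite_zero_mul_ite_zero, one_mul]
  apply if_congr _ rfl rfl
  simp only [max_lt_iff, le_min_iff]
  tauto

lemma pair_T {N j : ℕ} (hj2 : 2 ≤ j) {p q : ℕ} (hpq : p ≠ q) (hp : p.Prime) (hq : q.Prime)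
    (hp1 : 2^(2^j) < p) (hq1 : 2^(2^j) < q) (M : ℕ) (hM : 2^(2^j*220) ≤ M) :
    ∑ k ∈ Ioc M (2*M), rI j k * ((wt N k p * (fI N j (k*p) - V N j)) * (wt N k q * (fI N j (k*q) - V N j))) ≤
      Pi1 j * V N j^2 * M * (2 * (hh N j p q - 1) + 24/10^17) := by
  set α := max M (max (N/(4*p)) (N/(4*q))) with hα
  set β := min (2*M) (min (N/p) (N/q)) with hβ
  have hsub : Ioc α β ⊆ Ioc M (2*M) := by
    intro k hk
    rw [mem_Ioc] at *
    exact ⟨lt_of_le_of_lt (le_max_left _ _) hk.1, hk.2.trans (min_le_left _ _)⟩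
  have e : ∑ k ∈ Ioc M (2*M), rI j k * ((wt N k p * (fI N j (k*p) - V N j)) * (wt N k q * (fI N j (k*q) - V N j)))
      = ∑ k ∈ Ioc α β, rI j k * ((fI N j (k*p) - V N j) * (fI N j (k*q) - V N j)) := by
    rw [← sum_subset_zero_on_sdiff hsub (f := fun k => rI j k * ((fI N j (k*p) - V N j) * (fI N j (k*q) - V N j)))]
    · intro k hk
      rw [mem_sdiff] at hk
      have := wt_prod N M p q k hp.pos hq.pos hk.1
      rw [← hα, ← hβ, if_neg hk.2] at this
      linear_combination (rI j k * ((fI N j (k*p) - V N j) * (fI N j (k*q) - V N j))) * this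
    · intro k hk
      have := wt_prod N M p q k hp.pos hq.pos (hsub hk)
      rw [← hα, ← hβ, if_pos hk] at this
      linear_combination (-(rI j k * ((fI N j (k*p) - V N j) * (fI N j (k*q) - V N j)))) * this
  rw [e]
  by_cases h : α ≤ β
  · exact inner_pair hj2 hpq (cop_prime hp hp1) (cop_prime hq hq1) M α β hM (le_max_left _ _) h (min_le_left _ _)
  · rw [Ioc_eq_empty (by omega), sum_empty]
    have h1 := one_le_hh N j p q
    apply mul_nonneg (mul_nonneg (mul_nonneg (Pi1_nonneg j) (sq_nonneg _)) (Nat.cast_nonneg M))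
    have : (0:ℝ) ≤ 24/10^17 := by norm_num
    linarith

lemma logN_le {N j : ℕ} (h : Hyp N j) : Real.log N ≤ 2^17 * (2^j * Real.log 2) := by
  have h1 : (N:ℝ) ≤ 2^(2^j*2^17) := by exact_mod_cast h.2.2.le
  have h0 : 0 < N := lt_of_lt_of_le (by positivity) h.2.1
  have := Real.log_le_log (by exact_mod_cast h0) h1
  rw [Real.log_pow] at this
  push_cast at this
  linarith

lemma logPi {N j : ℕ} (h : Hyp N j) (j' : ℕ) : Real.log N * Pi1 (j+j') ≤ 2^17/2^j' := by
  have h1 := logN_le h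
  have h2 := Pi1_le (j+j')
  have h0 := Pi1_nonneg (j+j')
  rw [le_div_iff₀ (by positivity)]
  rw [pow_add] at h2
  calc Real.log N * Pi1 (j+j') * 2^j' ≤ (2^17 * (2^j * Real.log 2)) * Pi1 (j+j') * 2^j' := by gcongr
    _ = 2^17 * (Pi1 (j+j') * (2^j*2^j' * Real.log 2)) := by ring
    _ ≤ 2^17 * 1 := by gcongr
    _ = 2^17 := mul_one _

lemma sum_log_le (y Q : ℕ) : ∑ p ∈ pr y Q, Real.log p ≤ 1.4 * Q := by
  have h1 : ∑ p ∈ pr y Q, Real.log p ≤ Chebyshev.theta (Q:ℝ) := by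
    rw [Chebyshev.theta, Nat.floor_natCast]
    apply sum_le_sum_of_subset_of_nonneg
    · intro p hp
      have := mem_pr.1 hp
      simp only [mem_filter, mem_Ioc]
      exact ⟨⟨by omega, this.2.1⟩, this.2.2⟩
    · intro p _ _; exact Real.log_natCast_nonneg p
  have h2 := Chebyshev.theta_le_log4_mul_x (x := (Q:ℝ)) (by positivity)
  have h3 : Real.log 4 ≤ 1.4 := by
    rw [show (4:ℝ) = 2^2 by norm_num, Real.log_pow]
    have := Real.log_two_lt_d9
    push_cast; linarith
  have h4 : Real.log 4 * Q ≤ 1.4 * Q := by gcongr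
  linarith

lemma hX_lem (j l Q : ℕ) (hl : l ≤ 2^(2^j)) (hQ : yy j < Q) : 2^(2^j*220) * l^1 ≤ Q+1 := by
  rw [pow_one]
  have h1 : 2^(2^j*220) * 2^(2^j) ≤ yy j := by
    rw [yy_eq, ← pow_add]; apply Nat.pow_le_pow_right (by norm_num); omega
  exact (Nat.mul_le_mul_left _ hl).trans (h1.trans (hQ.le.trans (Nat.le_succ Q)))

lemma count_ap {N j : ℕ} (hj2 : 2 ≤ j) (Q : ℕ) (hQ : yy j < Q) (p l : ℕ) (hl : l ∈ LL N j) :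
    (#{q ∈ pr (yy j) Q | (p : ZMod l) = ((q:ℕ) : ZMod l)} : ℝ) ≤ 10 * (Q / (l:ℝ)) * Pi1 j := by
  classical
  have hl1 := mem_LL.1 hl
  have hlP : l ∈ PP j := LL_sub le_rfl hl
  have hWc : #(Wc N j ∅ l) = 1 := by rw [card_Wc cop_empty hl]; simp
  have key := SVAP hj2 (adm_Wc (N := N) (j := j) cop_empty (by simp)) (Q+1) l 1 (p % l) hlP hWc
    (hX_lem j l Q hl1.2.1 hQ) (by rw [pow_one]; exact Nat.mod_lt _ hl1.2.2.1.pos)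
  rw [dens_empty le_rfl] at key
  have hle : #{q ∈ pr (yy j) Q | (p : ZMod l) = ((q:ℕ) : ZMod l)} ≤ #{n ∈ range (Q+1) | Sif (PP j) (Wc N j ∅) n ∧ n % l^1 = p % l} := by
    apply card_le_card
    intro q hq
    rw [mem_filter] at hq ⊢
    have hq1 := mem_pr.1 hq.1
    refine ⟨mem_range.2 (Nat.lt_succ_of_le hq1.2.1), (sif_iff le_rfl cop_empty q).2 ⟨rough_prime hq1.2.2 (lt_of_le_of_lt (z_le_yy j) hq1.1), by simp⟩, ?_⟩
    rw [pow_one]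
    exact ((ZMod.natCast_eq_natCast_iff' _ _ _).1 hq.2).symm
  have hle2 : (#{q ∈ pr (yy j) Q | (p : ZMod l) = ((q:ℕ) : ZMod l)} : ℝ) ≤ #{n ∈ range (Q+1) | Sif (PP j) (Wc N j ∅) n ∧ n % l^1 = p % l} := by
    exact_mod_cast hle
  refine hle2.trans (key.trans ?_)
  apply mul_le_mul_of_nonneg_right _ (Pi1_nonneg j)
  rw [pow_one]
  have hl0 : (0:ℝ) < l := by exact_mod_cast hl1.2.2.1.pos
  have hQ1 : (1:ℝ) ≤ Q := by exact_mod_cast Nat.one_le_iff_ne_zero.2 (Nat.ne_of_gt (lt_of_le_of_lt (Nat.zero_le _) hQ))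
  have h6 : ((Q+1:ℕ):ℝ)/l ≤ 2*(Q/(l:ℝ)) := by
    rw [← mul_div_assoc]; apply div_le_div_of_nonneg_right _ hl0.le; push_cast; linarith
  linarith

lemma ap_sum {N j : ℕ} (h : Hyp N j) (Q : ℕ) (hQN : Q ≤ N) (hQ : yy j < Q) (p : ℕ) (hp : p.Prime) :
    ∑ q ∈ pr (yy j) Q with q ≠ p, Real.log q * (hh N j p q - 1) ≤ Q * (10 * 2^17 / 2^125) := by
  classical
  have hj2 : 2 ≤ j := by have := h.1; omega
  have hQ0 : 0 < Q := lt_of_le_of_lt (Nat.zero_le _) hQ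
  have hlogQ : Real.log Q ≤ Real.log N := Real.log_le_log (by exact_mod_cast hQ0) (by exact_mod_cast hQN)
  have hlogQ0 : 0 ≤ Real.log Q := Real.log_natCast_nonneg Q
  have hcount := fun l hl => count_ap (N := N) hj2 Q hQ p l hl
  calc ∑ q ∈ pr (yy j) Q with q ≠ p, Real.log q * (hh N j p q - 1)
      ≤ ∑ q ∈ pr (yy j) Q with q ≠ p, Real.log Q * ∑ l ∈ LL N j with (p : ZMod l) = ((q:ℕ) : ZMod l), cc l := by
        apply sum_le_sum
        intro q hq
        have hq1 := mem_pr.1 (mem_filter.1 hq).1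
        apply mul_le_mul _ (hh_le N j p q) _ hlogQ0
        · apply Real.log_le_log (by exact_mod_cast hq1.2.2.pos) (by exact_mod_cast hq1.2.1)
        · linarith [one_le_hh N j p q]
    _ ≤ ∑ q ∈ pr (yy j) Q, Real.log Q * ∑ l ∈ LL N j with (p : ZMod l) = ((q:ℕ) : ZMod l), cc l := by
        apply sum_le_sum_of_subset_of_nonneg (filter_subset _ _)
        intro q _ _
        apply mul_nonneg hlogQ0
        exact sum_nonneg (fun l _ => cc_nonneg l)
    _ = Real.log Q * ∑ l ∈ LL N j, cc l * #{q ∈ pr (yy j) Q | (p : ZMod l) = ((q:ℕ) : ZMod l)} := by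
        rw [← mul_sum]
        refine congrArg (fun t => Real.log Q * t) ?_
        simp only [sum_filter]
        rw [sum_comm]
        apply sum_congr rfl
        intro l _
        rw [card_filter]
        push_cast
        rw [mul_sum]
        apply sum_congr rfl
        intro q _
        split_ifs <;> simp
    _ ≤ Real.log Q * ∑ l ∈ LL N j, cc l * (10 * (Q / (l:ℝ)) * Pi1 j) := by
        gcongr with l hl
        · exact cc_nonneg l
        · exact hcount l hl
    _ = (Real.log Q * Pi1 j) * (10 * Q) * ∑ l ∈ LL N j, cc l / l := by
        rw [mul_sum, mul_sum]
        apply sum_congr rfl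
        intro l _; ring
    _ ≤ 2^17 * (10 * Q) * (1/2^125) := by
        have h1 := sum_cc N j (by have := h.1; omega)
        have h2 := logPi h 0
        have h3 : Real.log Q * Pi1 j ≤ 2^17 := by
          have : Real.log Q * Pi1 j ≤ Real.log N * Pi1 j := mul_le_mul_of_nonneg_right hlogQ (Pi1_nonneg j)
          simp only [add_zero, pow_zero, div_one] at h2
          linarith
        apply mul_le_mul _ h1 (sum_nonneg (fun l _ => div_nonneg (cc_nonneg l) (Nat.cast_nonneg l))) (by positivity)
        gcongr
    _ = _ := by ring

end CW

namespace CW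
open Finset

lemma log_small {N j : ℕ} (h : Hyp N j) : 10^18 * Real.log N ≤ (2:ℝ)^(2^j) * (2:ℝ)^(2^j) := by
  have h1 := logN_le h
  have h2 : (2:ℝ)^j ≤ 2^(2^j) := by
    apply pow_le_pow_right₀ (by norm_num); exact Nat.lt_two_pow_self.le
  have h3 : (10:ℝ)^18 * 2^17 ≤ 2^(2^j) := by
    have : (2:ℝ)^(2^7) ≤ 2^(2^j) := by
      apply pow_le_pow_right₀ (by norm_num)
      apply Nat.pow_le_pow_right (by norm_num)
      have := h.1; omega
    refine le_trans ?_ this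
    norm_num
  have h4 : Real.log 2 ≤ 1 := by have := Real.log_two_lt_d9; linarith
  have h5 : (2:ℝ)^j * Real.log 2 ≤ 2^(2^j) := by
    have : (0:ℝ) ≤ 2^j := pow_nonneg (by norm_num) _
    calc (2:ℝ)^j * Real.log 2 ≤ 2^j * 1 := mul_le_mul_of_nonneg_left h4 this
      _ ≤ _ := by rw [mul_one]; exact h2
  have h6 : (0:ℝ) ≤ 2^(2^j) := pow_nonneg (by norm_num) _
  generalize (2:ℝ)^(2^j) = Z at *
  generalize (2:ℝ)^j * Real.log 2 = u at *
  calc 10^18 * Real.log N ≤ 10^18 * (2^17 * u) := by gcongr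
    _ ≤ 10^18 * (2^17 * Z) := by gcongr
    _ = (10^18 * 2^17) * Z := by ring
    _ ≤ Z * Z := by gcongr

lemma yy_real (j : ℕ) : (yy j : ℝ) = ((2:ℝ)^(2^j))^256 := by
  rw [yy_eq]; push_cast; rw [pow_mul]

lemma Z_ge (j : ℕ) : (2:ℝ) ≤ 2^(2^j) := by
  calc (2:ℝ) = 2^1 := by norm_num
    _ ≤ _ := pow_le_pow_right₀ (by norm_num) Nat.one_le_two_pow

lemma diag_lem {N j : ℕ} (h : Hyp N j) (Q : ℕ) (hQ : yy j < Q) :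
    1.4 * Real.log N ≤ Pi1 j * V N j^2 * Q * (1/10^17) := by
  have h1 := log_small h
  have h2 := Pi1_ge j
  have h3 := V_ge N j
  have h4 : ((2:ℝ)^(2^j))^256 ≤ Q := by rw [← yy_real]; exact_mod_cast hQ.le
  have h6 := Z_ge j
  have h0 : 0 ≤ Real.log N := Real.log_natCast_nonneg N
  clear hQ h
  generalize (2:ℝ)^(2^j) = Z at *
  generalize Pi1 j = P at *
  generalize V N j = v at *
  generalize (Q:ℝ) = q at *
  have hZ : 0 < Z := by linarith
  have hP : 0 ≤ P := le_trans (by positivity) h2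
  have h7 : (1/Z) * (1/Z)^2 * Z^256 ≤ P * v^2 * q := by gcongr
  have h8 : (1/Z) * (1/Z)^2 * Z^256 = Z^253 := by field_simp
  rw [h8] at h7
  have h9 : Z^2 ≤ Z^253 := pow_le_pow_right₀ (by linarith) (by norm_num)
  have : Z^2 = Z * Z := sq Z
  have : 1.4 * Real.log N * 10^17 ≤ P * v^2 * q := by nlinarith
  linarith

noncomputable def GG (N j Q k : ℕ) : ℝ :=
  ∑ p ∈ pr (yy j) Q, Real.log p * (wt N k p * (fI N j (k*p) - V N j))

noncomputable def TT (N j M p q : ℕ) : ℝ :=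
  ∑ k ∈ Ioc M (2*M), rI j k * ((wt N k p * (fI N j (k*p) - V N j)) * (wt N k q * (fI N j (k*q) - V N j)))

lemma GG_expand (N j Q M : ℕ) : ∑ k ∈ Ioc M (2*M), rI j k * (GG N j Q k)^2 =
    ∑ p ∈ pr (yy j) Q, ∑ q ∈ pr (yy j) Q, Real.log p * Real.log q * TT N j M p q := by
  unfold TT
  simp only [mul_sum]
  have : ∀ p ∈ pr (yy j) Q, ∑ q ∈ pr (yy j) Q, ∑ k ∈ Ioc M (2*M), Real.log p * Real.log q * (rI j k * ((wt N k p * (fI N j (k*p) - V N j)) * (wt N k q * (fI N j (k*q) - V N j)))) = ∑ k ∈ Ioc M (2*M), ∑ q ∈ pr (yy j) Q, Real.log p * Real.log q * (rI j k * ((wt N k p * (fI N j (k*p) - V N j)) * (wt N k q * (fI N j (k*q) - V N j)))) := by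
    intro p _
    rw [sum_comm]
  rw [sum_congr rfl this, sum_comm]
  apply sum_congr rfl
  intro k _
  unfold GG
  rw [sq, sum_mul_sum, mul_sum]
  apply sum_congr rfl
  intro p _
  rw [mul_sum]
  apply sum_congr rfl
  intro q _
  ring

lemma TT_diag (N j M p : ℕ) : TT N j M p p ≤ M := by
  unfold TT
  calc _ ≤ ∑ k ∈ Ioc M (2*M), (1:ℝ) := by
        apply sum_le_sum
        intro k _
        have a1 := rI_le j k
        have a0 := rI_nonneg j k
        have b1 := wt_le N k p
        have b0 := wt_nonneg N k p
        have c : |fI N j (k*p) - V N j| ≤ 1 := by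
          rw [abs_le]
          have := fI_nonneg N j (k*p)
          have := fI_le N j (k*p)
          have := V_nonneg N j
          have := V_le_one N j
          constructor <;> linarith
        have d : |wt N k p * (fI N j (k*p) - V N j)| ≤ 1 := by
          rw [abs_mul, abs_of_nonneg b0]
          exact mul_le_one₀ b1 (abs_nonneg _) c
        have e := abs_le.1 d
        have : (wt N k p * (fI N j (k*p) - V N j)) * (wt N k p * (fI N j (k*p) - V N j)) ≤ 1 := by nlinarith
        have f0 : 0 ≤ (wt N k p * (fI N j (k*p) - V N j)) * (wt N k p * (fI N j (k*p) - V N j)) := mul_self_nonneg _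
        exact mul_le_one₀ a1 f0 this
    _ = M := by rw [sum_const, Nat.card_Ioc, nsmul_eq_mul, mul_one]; congr 1; omega

lemma M_ge {j M : ℕ} (hM : yy j ≤ M) : 2^(2^j*220) ≤ M := by
  refine le_trans ?_ hM
  rw [yy_eq]
  apply Nat.pow_le_pow_right (by norm_num); omega

lemma log_nn (p : ℕ) : 0 ≤ Real.log p := Real.log_natCast_nonneg p

lemma row {N j : ℕ} (h : Hyp N j) (M Q : ℕ) (hM : yy j ≤ M) (hQN : Q ≤ N) (hQ : yy j < Q)
    (p : ℕ) (hp : p ∈ pr (yy j) Q) :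
    ∑ q ∈ pr (yy j) Q, Real.log q * TT N j M p q ≤
      Real.log N * M + Pi1 j * V N j^2 * M * Q * (35/10^17) := by
  have hj2 : 2 ≤ j := le_trans (by norm_num) h.1
  have hp1 := mem_pr.1 hp
  have hM2 := M_ge hM
  set C := Pi1 j * V N j^2 * M with hC
  have hC0 : 0 ≤ C := mul_nonneg (mul_nonneg (Pi1_nonneg j) (sq_nonneg _)) (Nat.cast_nonneg M)
  rw [← sum_filter_add_sum_filter_not (pr (yy j) Q) (fun q => q ≠ p)]
  have e1 : ∑ q ∈ pr (yy j) Q with ¬ (q ≠ p), Real.log q * TT N j M p q = Real.log p * TT N j M p p := by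
    rw [sum_eq_single_of_mem p]
    · rw [mem_filter]; exact ⟨hp, fun h => h rfl⟩
    · intro q hq hne
      exact absurd hne (mem_filter.1 hq).2
  rw [e1]
  have hlogp : Real.log p ≤ Real.log N :=
    Real.log_le_log (Nat.cast_pos.2 hp1.2.2.pos) (Nat.cast_le.2 (hp1.2.1.trans hQN))
  have b1 : Real.log p * TT N j M p p ≤ Real.log N * M :=
    (mul_le_mul_of_nonneg_left (TT_diag N j M p) (log_nn p)).trans
      (mul_le_mul_of_nonneg_right hlogp (Nat.cast_nonneg M))
  have b2 : ∑ q ∈ pr (yy j) Q with q ≠ p, Real.log q * TT N j M p q ≤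
      ∑ q ∈ pr (yy j) Q with q ≠ p, (2 * C * (Real.log q * (hh N j p q - 1)) + C * (24/10^17) * Real.log q) := by
    apply sum_le_sum
    intro q hq
    have hq0 := mem_filter.1 hq
    have hq1 := mem_pr.1 hq0.1
    have t := pair_T (N := N) hj2 (Ne.symm hq0.2) hp1.2.2 hq1.2.2 (lt_of_le_of_lt (z_le_yy j) hp1.1)
      (lt_of_le_of_lt (z_le_yy j) hq1.1) M hM2
    have t2 := mul_le_mul_of_nonneg_left t (log_nn q)
    refine le_trans t2 (le_of_eq ?_)
    rw [hC]; ring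
  rw [sum_add_distrib, ← mul_sum, ← mul_sum] at b2
  have b3 := ap_sum h Q hQN hQ p hp1.2.2
  have b4 : ∑ q ∈ pr (yy j) Q with q ≠ p, Real.log q ≤ 1.4 * Q := by
    refine le_trans ?_ (sum_log_le (yy j) Q)
    exact sum_le_sum_of_subset_of_nonneg (filter_subset _ _) (fun q _ _ => log_nn q)
  have b5 := mul_le_mul_of_nonneg_left b3 (mul_nonneg (by norm_num : (0:ℝ) ≤ 2) hC0)
  have b6 := mul_le_mul_of_nonneg_left b4 (mul_nonneg hC0 (by norm_num : (0:ℝ) ≤ 24/10^17))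
  have hCQ : 0 ≤ C * Q := mul_nonneg hC0 (Nat.cast_nonneg Q)
  have b7 : 2 * C * (Q * (10 * 2^17 / 2^125)) + C * (24/10^17) * (1.4 * Q) ≤ C * Q * (35/10^17) := by
    have : (2:ℝ) * (10 * 2^17 / 2^125) + (24/10^17) * 1.4 ≤ 35/10^17 := by norm_num
    have := mul_le_mul_of_nonneg_left this hCQ
    linarith
  linarith

lemma block_var {N j : ℕ} (h : Hyp N j) (M Q : ℕ) (hM : yy j ≤ M) (hQN : Q ≤ N) :
    ∑ k ∈ Ioc M (2*M), rI j k * (GG N j Q k)^2 ≤ Pi1 j * V N j^2 * M * Q^2 * (1/10^15) := by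
  have hC0 : 0 ≤ Pi1 j * V N j^2 * M := mul_nonneg (mul_nonneg (Pi1_nonneg j) (sq_nonneg _)) (Nat.cast_nonneg M)
  by_cases hQ : yy j < Q
  · rw [GG_expand]
    have d := diag_lem h Q hQ
    set R := Real.log N * M + Pi1 j * V N j^2 * M * Q * (35/10^17) with hR
    have hR0 : 0 ≤ R := add_nonneg (mul_nonneg (log_nn N) (Nat.cast_nonneg M))
      (mul_nonneg (mul_nonneg hC0 (Nat.cast_nonneg Q)) (by norm_num))
    calc _ ≤ ∑ p ∈ pr (yy j) Q, Real.log p * R := by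
          apply sum_le_sum
          intro p hp
          have := mul_le_mul_of_nonneg_left (row h M Q hM hQN hQ p hp) (log_nn p)
          rw [mul_sum] at this
          refine le_trans (le_of_eq ?_) this
          apply sum_congr rfl
          intro q _; ring
      _ = (∑ p ∈ pr (yy j) Q, Real.log p) * R := by rw [sum_mul]
      _ ≤ (1.4 * Q) * R := mul_le_mul_of_nonneg_right (sum_log_le _ _) hR0
      _ = (1.4 * Real.log N) * (M * Q) + 1.4 * (35/10^17) * (Pi1 j * V N j^2 * M * Q^2) := by rw [hR]; ring
      _ ≤ (Pi1 j * V N j^2 * Q * (1/10^17)) * (M * Q) + 1.4 * (35/10^17) * (Pi1 j * V N j^2 * M * Q^2) := by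
          have := mul_le_mul_of_nonneg_right d (mul_nonneg (Nat.cast_nonneg M) (Nat.cast_nonneg Q) : (0:ℝ) ≤ M * Q)
          linarith
      _ = (1/10^17 + 1.4 * (35/10^17)) * (Pi1 j * V N j^2 * M * Q^2) := by ring
      _ ≤ (1/10^15) * (Pi1 j * V N j^2 * M * Q^2) := by
          apply mul_le_mul_of_nonneg_right (by norm_num) (mul_nonneg hC0 (sq_nonneg _))
      _ = _ := by ring
  · have : pr (yy j) Q = ∅ := by
      ext p; rw [mem_pr]; simp only [notMem_empty, iff_false]
      intro hp
      exact hQ (lt_of_lt_of_le hp.1 hp.2.1)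
    have g : ∀ k, GG N j Q k = 0 := by intro k; unfold GG; rw [this, sum_empty]
    rw [sum_eq_zero]
    · exact mul_nonneg (mul_nonneg hC0 (sq_nonneg _)) (by norm_num)
    · intro k _; rw [g]; ring

lemma rI_mono {j j' : ℕ} (h : j ≤ j') (k : ℕ) : rI j' k ≤ rI j k := by
  unfold rI
  split_ifs with h1 h2 h2
  · exact le_rfl
  · exact absurd (fun l hl => h1 l (by
      have hl2 := mem_pr.1 hl
      refine mem_pr.2 ⟨hl2.1, hl2.2.1.trans ?_, hl2.2.2⟩
      exact Nat.pow_le_pow_right (by norm_num) (Nat.pow_le_pow_right (by norm_num) h))) h2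
  · norm_num
  · exact le_rfl

lemma sum_rI {j M : ℕ} (hj2 : 2 ≤ j) (hM : yy j ≤ M) : ∑ k ∈ Ioc M (2*M), rI j k ≤ 1.1 * (M * Pi1 j) := by
  have a0 := CSI hj2 le_rfl (N := 0) (j := j) cop_empty (by simp) M (2*M) (M_ge hM) (Nat.le_mul_of_pos_left M (by norm_num))
  rw [dens_empty le_rfl] at a0
  simp only [prod_empty, mul_one] at a0
  have c := (abs_le.1 a0).2
  have hM1 : (1:ℝ) ≤ M := Nat.one_le_cast.2 (le_trans Nat.one_le_two_pow (M_ge hM))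
  have hP := Pi1_nonneg j
  have : 0 ≤ (M - 1) * Pi1 j := mul_nonneg (by linarith) hP
  have : 0 ≤ M * Pi1 j := mul_nonneg (by linarith) hP
  push_cast at c
  clear a0 hM
  generalize Pi1 j = P at *
  generalize (M:ℝ) = m at *
  nlinarith

lemma block_bound {N j : ℕ} (h : Hyp N j) (M : ℕ) (hM : yy j ≤ M) :
    |∑ k ∈ Ioc M (2*M), rI (j+8) k * GG N j (N/M) k| ≤ N * (Pi1 j * V N j) * (4/10^8) := by
  have hj2 : 2 ≤ j := le_trans (by norm_num) h.1
  have v := block_var h M (N/M) hM (Nat.div_le_self _ _)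
  have s := sum_rI hj2 hM
  have hMQ : (M:ℝ) * (N/M : ℕ) ≤ N := by exact_mod_cast Nat.mul_div_le N M
  have hMQ0 : (0:ℝ) ≤ (M:ℝ) * (N/M : ℕ) := mul_nonneg (Nat.cast_nonneg _) (Nat.cast_nonneg _)
  have hPV : 0 ≤ Pi1 j * V N j := mul_nonneg (Pi1_nonneg j) (V_nonneg N j)
  have hr := mul_nonneg (mul_nonneg (Nat.cast_nonneg N) hPV) (by norm_num : (0:ℝ) ≤ 4/10^8)
  have a1 : |∑ k ∈ Ioc M (2*M), rI (j+8) k * GG N j (N/M) k| ≤ ∑ k ∈ Ioc M (2*M), rI j k * |GG N j (N/M) k| := by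
    refine (abs_sum_le_sum_abs _ _).trans (sum_le_sum fun k _ => ?_)
    rw [abs_mul, abs_of_nonneg (rI_nonneg _ _)]
    exact mul_le_mul_of_nonneg_right (rI_mono (Nat.le_add_right j 8) k) (abs_nonneg _)
  refine a1.trans (abs_le_of_sq_le_sq' ?_ hr).2
  have cs : (∑ k ∈ Ioc M (2*M), rI j k * |GG N j (N/M) k|)^2 ≤
      (∑ k ∈ Ioc M (2*M), rI j k) * ∑ k ∈ Ioc M (2*M), rI j k * (GG N j (N/M) k)^2 := by
    apply sum_sq_le_sum_mul_sum_of_sq_eq_mul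
    · intro k _; exact rI_nonneg j k
    · intro k _; exact mul_nonneg (rI_nonneg j k) (sq_nonneg _)
    · intro k _; rw [mul_pow, sq_abs]; ring
  refine cs.trans ?_
  have nn : 0 ≤ ∑ k ∈ Ioc M (2*M), rI j k * (GG N j (N/M) k)^2 :=
    sum_nonneg fun k _ => mul_nonneg (rI_nonneg j k) (sq_nonneg _)
  refine (mul_le_mul s v nn (mul_nonneg (by norm_num) (mul_nonneg (Nat.cast_nonneg _) (Pi1_nonneg j)))).trans ?_
  calc _ = (1.1/10^15) * ((M:ℝ) * (N/M : ℕ))^2 * (Pi1 j * V N j)^2 := by ring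
    _ ≤ (16/10^16) * (N:ℝ)^2 * (Pi1 j * V N j)^2 := by
        apply mul_le_mul_of_nonneg_right _ (sq_nonneg _)
        apply mul_le_mul (by norm_num) (pow_le_pow_left₀ hMQ0 hMQ 2) (sq_nonneg _) (by norm_num)
    _ = _ := by ring

end CW

namespace CW
open Finset

lemma mem_I {N n : ℕ} : n ∈ Ioc (N/4) N ↔ N < 4*n ∧ n ≤ N := by
  rw [mem_Ioc, Nat.div_lt_iff_lt_mul (by norm_num), mul_comm]

/-- Prime factors of rough numbers are large. -/
lemma rough_lt {j n p : ℕ} (h : Rough (j+8) n) (hp : p.Prime) (hd : p ∣ n) : yy j < p := by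
  by_contra hc
  exact h p (mem_pr.2 ⟨hp.pos, by unfold yy at hc; exact not_lt.1 hc, hp⟩) hd

lemma rough_ne {j n : ℕ} (h : rI (j+8) n ≠ 0) : Rough (j+8) n := by
  by_contra hc
  exact h (by unfold rI; rw [if_neg hc])

lemma rI_mul {j p : ℕ} (hp : p.Prime) (hy : yy j < p) (k : ℕ) : rI (j+8) (k*p) = rI (j+8) k := by
  classical
  unfold rI
  apply if_congr _ rfl rfl
  constructor
  · intro h l hl hd; exact h l hl (hd.mul_right p)
  · intro h l hl hd
    have hl1 := mem_pr.1 hl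
    rcases (hl1.2.2.dvd_mul).1 hd with h1 | h1
    · exact h l hl h1
    · have := (Nat.prime_dvd_prime_iff_eq hl1.2.2 hp).1 h1
      unfold yy at hy
      exact absurd hl1.2.1 (not_le.2 (this ▸ hy))

lemma rI_small {j k : ℕ} (h1 : 1 < k) (hy : k ≤ yy j) : rI (j+8) k = 0 := by
  by_contra hc
  have h := rough_ne hc
  have h2 := rough_lt h (Nat.minFac_prime (Nat.ne_of_gt h1)) (Nat.minFac_dvd k)
  exact absurd (Nat.minFac_le (by omega : 0 < k)) (not_le.2 (lt_of_le_of_lt hy h2))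

/-- sum of logs of proper prime divisors -/
noncomputable def lam (n : ℕ) : ℝ := ∑ p ∈ n.primeFactors with p < n, Real.log p

lemma lam_eq {N j n : ℕ} (hn : n ∈ Ioc (N/4) N) (h : Rough (j+8) n) :
    lam n = ∑ p ∈ pr (yy j) N with p ∣ n ∧ p < n, Real.log p := by
  unfold lam
  apply sum_congr _ (fun _ _ => rfl)
  have hn1 := mem_I.1 hn
  ext p
  rw [mem_filter, mem_filter, Nat.mem_primeFactors, mem_pr]
  constructor
  · rintro ⟨⟨a, b, c⟩, d⟩
    exact ⟨⟨rough_lt h a b, (d.le.trans hn1.2), a⟩, b, d⟩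
  · rintro ⟨⟨a, b, c⟩, d, e⟩
    exact ⟨⟨c, d, by omega⟩, e⟩

lemma inner_p (N j K p : ℕ) (hK : N ≤ K) (hp : p.Prime) (hy : yy j < p) (f : ℕ → ℝ) :
    ∑ n ∈ Ioc (N/4) N with p ∣ n ∧ p < n, rI (j+8) n * f n =
      ∑ k ∈ Ioc (yy j) K, rI (j+8) k * (wt N k p * f (k*p)) := by
  have e1 : ∑ n ∈ Ioc (N/4) N with p ∣ n ∧ p < n, rI (j+8) n * f n =
      ∑ k ∈ Ioc 1 K with N < 4*(k*p) ∧ k*p ≤ N, rI (j+8) (k*p) * f (k*p) := by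
    symm
    apply sum_nbij' (fun k => k*p) (fun n => n/p)
    · intro k hk
      rw [mem_filter, mem_Ioc] at hk
      rw [mem_filter, mem_I]
      exact ⟨hk.2, Nat.dvd_mul_left p k, by have := hp.pos; nlinarith [hk.1.1]⟩
    · intro n hn
      rw [mem_filter, mem_I] at hn
      rw [mem_filter, mem_Ioc, Nat.div_mul_cancel hn.2.1]
      refine ⟨⟨?_, (Nat.div_le_self n p).trans (hn.1.2.trans hK)⟩, hn.1⟩
      obtain ⟨c, hc⟩ := hn.2.1
      rw [hc, Nat.mul_div_cancel_left c hp.pos]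
      by_contra hcc
      have : p * c ≤ p * 1 := Nat.mul_le_mul_left p (not_lt.1 hcc)
      rw [← hc, mul_one] at this
      exact absurd hn.2.2 (not_lt.2 this)
    · intro k _; exact Nat.mul_div_cancel k hp.pos
    · intro n hn
      rw [mem_filter] at hn
      exact Nat.div_mul_cancel hn.2.1
    · intro k _; rfl
  rw [e1, sum_filter]
  have e2 : ∀ k ∈ Ioc 1 K, (if N < 4*(k*p) ∧ k*p ≤ N then rI (j+8) (k*p) * f (k*p) else 0) =
      rI (j+8) k * (wt N k p * f (k*p)) := by
    intro k _
    rw [rI_mul hp hy]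
    unfold wt
    split_ifs <;> ring
  rw [sum_congr rfl e2]
  symm
  apply sum_subset
  · intro k hk
    rw [mem_Ioc] at *
    have : 1 ≤ yy j := by unfold yy; exact Nat.one_le_two_pow
    exact ⟨lt_of_le_of_lt this hk.1, hk.2⟩
  · intro k hk hk2
    rw [mem_Ioc] at *
    have : k ≤ yy j := by
      by_contra hc
      exact hk2 ⟨not_le.1 hc, hk.2⟩
    rw [rI_small hk.1 this, zero_mul]

lemma dyadic (f : ℕ → ℝ) (s t : ℕ) (h : s ≤ t) :
    ∑ k ∈ Ioc (2^s) (2^t), f k = ∑ i ∈ Ico s t, ∑ k ∈ Ioc (2^i) (2*2^i), f k := by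
  induction t, h using Nat.le_induction with
  | base => simp
  | succ t ht ih =>
    rw [sum_Ico_succ_top ht, ← ih, ← pow_succ']
    exact (sum_Ioc_consecutive f (Nat.pow_le_pow_right (by norm_num) ht) (Nat.pow_le_pow_right (by norm_num) (Nat.le_succ t))).symm

noncomputable def DD (N j : ℕ) : ℝ := ∑ n ∈ Ioc (N/4) N, rI (j+8) n * ((fI N j n - V N j) * lam n)

lemma GG_full (N j i k : ℕ) (hk : k ∈ Ioc (2^i) (2*2^i)) : GG N j (N/2^i) k = GG N j N k := by
  unfold GG
  apply sum_subset
  · intro p hp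
    have := mem_pr.1 hp
    exact mem_pr.2 ⟨this.1, this.2.1.trans (Nat.div_le_self _ _), this.2.2⟩
  · intro p hp hp2
    have h1 := mem_pr.1 hp
    have h2 : N/2^i < p := by
      by_contra hc
      exact hp2 (mem_pr.2 ⟨h1.1, not_lt.1 hc, h1.2.2⟩)
    rw [Nat.div_lt_iff_lt_mul (by positivity)] at h2
    have : wt N k p = 0 := by
      unfold wt
      rw [if_neg]
      intro h3
      have h4 : p * 2^i ≤ k * p := by
        rw [mul_comm k p]; exact Nat.mul_le_mul_left p (mem_Ioc.1 hk).1.le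
      exact absurd (lt_of_lt_of_le h2 (h4.trans h3.2)) (lt_irrefl _)
    rw [this]; ring

lemma DD_eq (N j s t : ℕ) (hst : s ≤ t) (hs : yy j = 2^s) (hN : N ≤ 2^t) :
    DD N j = ∑ i ∈ Ico s t, ∑ k ∈ Ioc (2^i) (2*2^i), rI (j+8) k * GG N j (N/2^i) k := by
  have e1 : DD N j = ∑ n ∈ Ioc (N/4) N, ∑ p ∈ pr (yy j) N,
      if p ∣ n ∧ p < n then Real.log p * (rI (j+8) n * (fI N j n - V N j)) else 0 := by
    unfold DD
    apply sum_congr rfl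
    intro n hn
    rw [← sum_filter]
    by_cases hr : rI (j+8) n = 0
    · simp only [hr, zero_mul, mul_zero, sum_const_zero]
    · rw [lam_eq hn (rough_ne hr), mul_sum, mul_sum]
      apply sum_congr rfl
      intro p _; ring
  have e2 : DD N j = ∑ p ∈ pr (yy j) N, ∑ k ∈ Ioc (yy j) (2^t), Real.log p * (rI (j+8) k * (wt N k p * (fI N j (k*p) - V N j))) := by
    rw [e1, sum_comm]
    apply sum_congr rfl
    intro p hp
    have hp1 := mem_pr.1 hp
    rw [← sum_filter, ← mul_sum, ← mul_sum, inner_p N j (2^t) p hN hp1.2.2 hp1.1 (fun n => fI N j n - V N j)]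
  rw [e2, sum_comm]
  have e3 : ∀ k ∈ Ioc (yy j) (2^t), ∑ p ∈ pr (yy j) N, Real.log p * (rI (j+8) k * (wt N k p * (fI N j (k*p) - V N j)))
     = rI (j+8) k * GG N j N k := by
    intro k _
    unfold GG
    rw [mul_sum]
    apply sum_congr rfl
    intro p _; ring
  rw [sum_congr rfl e3, hs, dyadic _ s t hst]
  apply sum_congr rfl
  intro i _
  apply sum_congr rfl
  intro k hk
  rw [GG_full N j i k hk]

lemma DD_bound {N j : ℕ} (h : Hyp N j) : |DD N j| ≤ N * V N j * (1/100) := by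
  have hst : 2^j*256 ≤ 2^j*2^17 := Nat.mul_le_mul_left _ (by norm_num)
  rw [DD_eq N j (2^j*256) (2^j*2^17) hst (yy_eq j) h.2.2.le]
  have b : ∀ i ∈ Ico (2^j*256) (2^j*2^17), |∑ k ∈ Ioc (2^i) (2*2^i), rI (j+8) k * GG N j (N/2^i) k| ≤ N * (Pi1 j * V N j) * (4/10^8) := by
    intro i hi
    apply block_bound h
    rw [yy_eq]
    exact Nat.pow_le_pow_right (by norm_num) (mem_Ico.1 hi).1
  refine (abs_sum_le_sum_abs _ _).trans ((sum_le_card_nsmul _ _ _ b).trans ?_)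
  rw [nsmul_eq_mul, Nat.card_Ico]
  have hc : ((2^j*2^17 - 2^j*256 : ℕ) : ℝ) ≤ 2^j*2^17 := by
    have : (2^j*2^17 - 2^j*256 : ℕ) ≤ 2^j*2^17 := Nat.sub_le _ _
    exact_mod_cast this
  have hv := V_nonneg N j
  have hP := Pi1_nonneg j
  have hPl := Pi1_le j
  have hl := Real.log_two_gt_d9
  have hN : (0:ℝ) ≤ N := Nat.cast_nonneg N
  have hj0 : (0:ℝ) ≤ 2^j := pow_nonneg (by norm_num) j
  clear b hst h
  generalize ((2^j*2^17 - 2^j*256 : ℕ) : ℝ) = c at *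
  generalize (2:ℝ)^j = a at *
  generalize Pi1 j = P at *
  generalize V N j = v at *
  have hPa : P * a * 0.69 ≤ 1 := by
    have : P * (a * 0.69) ≤ P * (a * Real.log 2) := by
      apply mul_le_mul_of_nonneg_left _ hP
      apply mul_le_mul_of_nonneg_left _ hj0; linarith
    linarith
  calc c * (N * (P*v) * (4/10^8)) ≤ (a * 2^17) * (N * (P*v) * (4/10^8)) := by
        apply mul_le_mul_of_nonneg_right hc; positivity
    _ = (N * v) * ((P * a * 0.69) * (2^17*(4/10^8)/0.69)) := by ring
    _ ≤ (N * v) * (1 * (2^17*(4/10^8)/0.69)) := by gcongr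
    _ ≤ (N * v) * (1/100) := by
        apply mul_le_mul_of_nonneg_left _ (by positivity); norm_num

end CW

namespace CW
open Finset

lemma lam_nonneg (n : ℕ) : 0 ≤ lam n := sum_nonneg fun p _ => log_nn p

lemma sum_log_pf (n : ℕ) : ∑ p ∈ n.primeFactors, Real.log p = Real.log ((∏ p ∈ n.primeFactors, p : ℕ)) := by
  push_cast
  rw [Real.log_prod]
  intro p hp
  exact_mod_cast (Nat.prime_of_mem_primeFactors hp).ne_zero

lemma lam_le {n : ℕ} (hn : 0 < n) : lam n ≤ Real.log n := by
  unfold lam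
  calc _ ≤ ∑ p ∈ n.primeFactors, Real.log p :=
        sum_le_sum_of_subset_of_nonneg (filter_subset _ _) (fun p _ _ => log_nn p)
    _ = _ := sum_log_pf n
    _ ≤ Real.log n := by
        apply Real.log_le_log
        · exact_mod_cast prod_pos (fun p hp => (Nat.prime_of_mem_primeFactors hp).pos)
        · exact_mod_cast Nat.le_of_dvd hn (Nat.prod_primeFactors_dvd n)

lemma lam_prime {n : ℕ} (hn : n.Prime) : lam n = 0 := by
  unfold lam
  rw [hn.primeFactors, sum_filter, sum_singleton, if_neg (lt_irrefl n)]

lemma lam_sqf {n : ℕ} (hn : ¬ n.Prime) (hs : Squarefree n) : lam n = Real.log n := by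
  unfold lam
  rw [filter_true_of_mem, sum_log_pf, Nat.prod_primeFactors_of_squarefree hs]
  intro p hp
  refine lt_of_le_of_ne (Nat.le_of_mem_primeFactors hp) ?_
  rintro rfl
  exact hn (Nat.prime_of_mem_primeFactors hp)

open Classical in
noncomputable def pI (n : ℕ) : ℝ := if n.Prime then 1 else 0

open Classical in
noncomputable def qI (y n : ℕ) : ℝ := if ∃ p, y < p ∧ p^2 ∣ n then 1 else 0

lemma pI_nonneg (n : ℕ) : 0 ≤ pI n := by unfold pI; split_ifs <;> norm_num
lemma qI_nonneg (y n : ℕ) : 0 ≤ qI y n := by unfold qI; split_ifs <;> norm_num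

lemma log_four_nn : 0 ≤ Real.log 4 := Real.log_nonneg (by norm_num)

lemma pointwise {N j n : ℕ} (hn : n ∈ Ioc (N/4) N) :
    rI (j+8) n * (Real.log N - lam n - Real.log 4 - Real.log N * qI (yy j) n) ≤ Real.log N * pI n * rI (j+8) n := by
  have hn1 := mem_I.1 hn
  by_cases hr : rI (j+8) n = 0
  · rw [hr]; simp
  have hR := rough_ne hr
  have hr0 := rI_nonneg (j+8) n
  rw [mul_comm]
  apply mul_le_mul_of_nonneg_right _ hr0
  have hq := qI_nonneg (yy j) n
  have hl := log_nn N
  have hlq := mul_nonneg hl hq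
  have h4 := log_four_nn
  have hlam := lam_nonneg n
  by_cases hp : n.Prime
  · have : pI n = 1 := by unfold pI; rw [if_pos hp]
    rw [this]; linarith
  · have : pI n = 0 := by unfold pI; rw [if_neg hp]
    rw [this]
    by_cases hs : Squarefree n
    · rw [lam_sqf hp hs]
      have hn0 : (0:ℝ) < n := by exact_mod_cast (by omega : 0 < n)
      have : Real.log N ≤ Real.log (4 * n) := by
        apply Real.log_le_log
        · exact_mod_cast (by omega : 0 < N)
        · exact_mod_cast hn1.1.le
      rw [Real.log_mul (by norm_num) hn0.ne'] at this
      linarith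
    · have : qI (yy j) n = 1 := by
        unfold qI
        rw [if_pos]
        rw [Nat.squarefree_iff_prime_squarefree] at hs
        push Not at hs
        obtain ⟨p, hp, hd⟩ := hs
        refine ⟨p, rough_lt hR hp (dvd_trans (dvd_mul_right p p) hd), by rw [sq]; exact hd⟩
      rw [this]
      linarith

lemma count_q (y N : ℕ) (hy : 0 < y) : ∑ n ∈ Ioc (N/4) N, qI y n ≤ N / y := by
  classical
  have e : ∀ n ∈ Ioc (N/4) N, qI y n ≤ ∑ d ∈ Ioc y N, if d^2 ∣ n then (1:ℝ) else 0 := by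
    intro n hn
    have hn1 := mem_I.1 hn
    unfold qI
    split_ifs with h
    · obtain ⟨p, h1, h2⟩ := h
      have hpN : p ≤ N := by
        have h3 := Nat.le_of_dvd (by omega) h2
        have h4 : p ≤ p^2 := Nat.le_self_pow (by norm_num) p
        exact h4.trans (h3.trans hn1.2)
      calc (1:ℝ) = if p^2 ∣ n then (1:ℝ) else 0 := by rw [if_pos h2]
        _ ≤ _ := single_le_sum (f := fun d => if d^2 ∣ n then (1:ℝ) else 0) (fun d _ => by split_ifs <;> norm_num) (mem_Ioc.2 ⟨h1, hpN⟩)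
    · exact sum_nonneg (fun d _ => by split_ifs <;> norm_num)
  refine (sum_le_sum e).trans ?_
  rw [sum_comm]
  have f : ∀ d ∈ Ioc y N, (∑ n ∈ Ioc (N/4) N, if d^2 ∣ n then (1:ℝ) else 0) ≤ N * ((d:ℝ)^2)⁻¹ := by
    intro d hd
    rw [← sum_filter, sum_const, nsmul_eq_mul, mul_one]
    have h1 : #{n ∈ Ioc (N/4) N | d^2 ∣ n} ≤ N / d^2 := by
      rw [← Nat.Ioc_filter_dvd_card_eq_div N (d^2)]
      apply card_le_card
      apply filter_subset_filter
      intro n hn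
      rw [mem_Ioc] at *
      omega
    calc (#{n ∈ Ioc (N/4) N | d^2 ∣ n} : ℝ) ≤ ((N / d^2 : ℕ) : ℝ) := by exact_mod_cast h1
      _ ≤ (N:ℝ) / ((d^2 : ℕ) : ℝ) := Nat.cast_div_le
      _ = _ := by push_cast; rw [div_eq_mul_inv]
  refine (sum_le_sum f).trans ?_
  rw [← mul_sum]
  by_cases hyN : y ≤ N
  · have := sum_Ioc_inv_sq_le_sub (α := ℝ) hy.ne' hyN
    have h3 : (0:ℝ) ≤ (N:ℝ)⁻¹ := by positivity
    rw [div_eq_mul_inv]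
    apply mul_le_mul_of_nonneg_left _ (Nat.cast_nonneg N)
    linarith
  · rw [Ioc_eq_empty (by omega), sum_empty, mul_zero]
    positivity

/-- Abstract assembly. -/
lemma assemble (N j : ℕ) :
    V N j * ∑ n ∈ Ioc (N/4) N, rI (j+8) n * (Real.log N - lam n)
      + Real.log N * ∑ n ∈ Ioc (N/4) N, rI (j+8) n * (fI N j n - V N j) - DD N j
      - Real.log 4 * ∑ n ∈ Ioc (N/4) N, rI (j+8) n * fI N j n
      - Real.log N * ∑ n ∈ Ioc (N/4) N, qI (yy j) n
    ≤ Real.log N * ∑ n ∈ Ioc (N/4) N, pI n * fI N j n := by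
  unfold DD
  simp only [mul_sum]
  rw [← sum_add_distrib, ← sum_sub_distrib, ← sum_sub_distrib, ← sum_sub_distrib]
  apply sum_le_sum
  intro n hn
  have h1 := mul_le_mul_of_nonneg_right (pointwise (j := j) hn) (fI_nonneg N j n)
  have hr0 := rI_nonneg (j+8) n
  have hr1 := rI_le (j+8) n
  have hf0 := fI_nonneg N j n
  have hf1 := fI_le N j n
  have hq := mul_nonneg (log_nn N) (qI_nonneg (yy j) n)
  have hp := mul_nonneg (mul_nonneg (log_nn N) (pI_nonneg n)) hf0
  have h2 : rI (j+8) n * fI N j n * (Real.log N * qI (yy j) n) ≤ 1 * (Real.log N * qI (yy j) n) :=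
    mul_le_mul_of_nonneg_right (mul_le_one₀ hr1 hf0 hf1) hq
  have h3 : Real.log N * pI n * fI N j n * rI (j+8) n ≤ Real.log N * pI n * fI N j n * 1 :=
    mul_le_mul_of_nonneg_left hr1 hp
  linarith

end CW

namespace CW
open Finset

lemma quarter {N j : ℕ} (h : Hyp N j) : 2^(2^(j+8)*220) ≤ N/4 := by
  rw [Nat.le_div_iff_mul_le (by norm_num)]
  refine le_trans ?_ h.2.1
  rw [show (4:ℕ) = 2^2 by norm_num, ← pow_add]
  apply Nat.pow_le_pow_right (by norm_num)
  rw [pow_add]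
  have : 1 ≤ 2^j := Nat.one_le_two_pow
  omega

lemma N_ge {N j : ℕ} (h : Hyp N j) : ((2:ℝ)^(2^j))^4 ≤ N := by
  have h1 : (2:ℕ)^(2^j*4) ≤ N := by
    refine le_trans ?_ h.2.1
    apply Nat.pow_le_pow_right (by norm_num)
    exact Nat.mul_le_mul_left _ (by norm_num)
  rw [← pow_mul]
  exact_mod_cast h1

lemma rI_prime {N j n : ℕ} (h : Hyp N j) (hn : n ∈ Ioc (N/4) N) (hp : n.Prime) : rI (j+8) n = 1 := by
  unfold rI
  rw [if_pos]
  apply rough_prime hp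
  refine lt_of_le_of_lt ?_ (mem_Ioc.1 hn).1
  refine le_trans ?_ (quarter h)
  apply Nat.pow_le_pow_right (by norm_num)
  exact Nat.le_mul_of_pos_right _ (by norm_num)

lemma Z_big {N j : ℕ} (h : Hyp N j) : (10:ℝ)^8 ≤ 2^(2^j) := by
  have h1 : (2:ℝ)^(2^7) ≤ 2^(2^j) := by
    apply pow_le_pow_right₀ (by norm_num)
    exact Nat.pow_le_pow_right (by norm_num) (le_trans (by norm_num) h.1)
  refine le_trans ?_ h1
  norm_num

lemma theta_part {N j : ℕ} (h : Hyp N j) : 0.3 * (N:ℝ) ≤ ∑ n ∈ Ioc (N/4) N, rI (j+8) n * (Real.log N - lam n) := by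
  have h1 : Chebyshev.theta (N:ℝ) - Chebyshev.theta ((N/4:ℕ):ℝ) ≤ ∑ n ∈ Ioc (N/4) N, rI (j+8) n * (Real.log N - lam n) := by
    have e : Chebyshev.theta (N:ℝ) - Chebyshev.theta ((N/4:ℕ):ℝ) = ∑ n ∈ Ioc (N/4) N with n.Prime, Real.log n := by
      rw [Chebyshev.theta, Chebyshev.theta, Nat.floor_natCast, Nat.floor_natCast, sub_eq_iff_eq_add, add_comm]
      simp only [sum_filter]
      exact (sum_Ioc_consecutive _ (Nat.zero_le _) (Nat.div_le_self N 4)).symm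
    rw [e, sum_filter]
    apply sum_le_sum
    intro n hn
    have hn1 := mem_I.1 hn
    have hn0 : 0 < n := by omega
    have hlog : Real.log n ≤ Real.log N := Real.log_le_log (Nat.cast_pos.2 hn0) (Nat.cast_le.2 hn1.2)
    split_ifs with hp
    · rw [rI_prime h hn hp, lam_prime hp]; linarith
    · apply mul_nonneg (rI_nonneg _ _)
      linarith [lam_le hn0]
  refine le_trans ?_ h1
  have a1 := Chebyshev.theta_ge N
  have a2 := Chebyshev.theta_le_log4_mul_x (x := ((N/4:ℕ):ℝ)) (Nat.cast_nonneg _)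
  have a3 : ((N/4:ℕ):ℝ) ≤ (N:ℝ)/4 := Nat.cast_div_le
  have a4 : Real.log 4 = 2 * Real.log 2 := by
    rw [show (4:ℝ) = 2^2 by norm_num, Real.log_pow]; push_cast; ring
  have b1 := log_small h
  have b2 := N_ge h
  have b3 := Z_ge j
  have b4 := Real.log_two_gt_d9
  have hN0 : (1:ℝ) ≤ N := le_trans (one_le_pow₀ (by linarith)) b2
  have c1 : Real.log (N+1) ≤ Real.log N + 1 := by
    calc Real.log (N+1) ≤ Real.log (N * 2) := Real.log_le_log (by linarith) (by linarith)
      _ = Real.log N + Real.log 2 := by rw [Real.log_mul (by linarith) (by norm_num)]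
      _ ≤ _ := by have := Real.log_two_lt_d9; linarith
  have c2 : (2:ℝ)^(2^j) * 2^(2^j) ≤ √N := by
    apply Real.le_sqrt_of_sq_le
    refine le_trans (le_of_eq ?_) b2
    generalize (2:ℝ)^(2^j) = Z; ring
  have hs : √(N:ℝ) * √N = N := Real.mul_self_sqrt (Nat.cast_nonneg N)
  have c3 : 10^18 * Real.log N ≤ √N := b1.trans c2
  have c4 : 10^8 ≤ √(N:ℝ) := by
    refine le_trans ?_ c2
    have := Z_big h
    generalize (2:ℝ)^(2^j) = Z at *; nlinarith
  have hl := log_nn N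
  have a5 : Real.log 4 * ((N/4:ℕ):ℝ) ≤ 2 * Real.log 2 * ((N:ℝ)/4) := by
    rw [a4]; apply mul_le_mul_of_nonneg_left a3; linarith
  clear h h1 b1 b2 b3 c2
  generalize √(N:ℝ) = s at *
  generalize Real.log N = u at *
  generalize (N:ℝ) = x at *
  have c5 : s * u ≤ x / 10^18 := by
    rw [le_div_iff₀ (by norm_num)]; nlinarith
  have c6 : 10^8 ≤ x := by nlinarith
  nlinarith

lemma sums_part {N j : ℕ} (h : Hyp N j) :
    |∑ n ∈ Ioc (N/4) N, rI (j+8) n * (fI N j n - V N j)| ≤ (6/10^17) * (N * Pi1 (j+8) * V N j) ∧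
    ∑ n ∈ Ioc (N/4) N, rI (j+8) n * fI N j n ≤ 2 * (N * Pi1 (j+8) * V N j) := by
  have hj2 : 2 ≤ j + 8 := le_trans (by norm_num) (Nat.le_add_left 8 j)
  have hjj : j ≤ j + 8 := Nat.le_add_right j 8
  have hc1 : Cop N j {1} := by
    intro p hp l hl hd
    rw [mem_singleton] at hp
    subst hp
    exact (mem_LL.1 hl).2.2.1.one_lt.ne' (Nat.dvd_one.1 hd)
  have a0 := CSI hj2 hjj (N := N) cop_empty (by simp) (N/4) N (quarter h) (Nat.div_le_self N 4)
  have a1 := CSI hj2 hjj hc1 (by simp) (N/4) N (quarter h) (Nat.div_le_self N 4)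
  rw [dens_empty hjj] at a0
  rw [dens_one hjj hc1] at a1
  simp only [prod_empty, mul_one, prod_singleton] at a0 a1
  have e : ∑ n ∈ Ioc (N/4) N, rI (j+8) n * (fI N j n - V N j) =
      ∑ n ∈ Ioc (N/4) N, rI (j+8) n * fI N j n - V N j * ∑ n ∈ Ioc (N/4) N, rI (j+8) n := by
    rw [mul_sum, ← sum_sub_distrib]
    apply sum_congr rfl
    intro n _; ring
  rw [e]
  have hN : (10:ℝ)^8 ≤ N := by
    have := Z_big h
    refine le_trans ?_ (N_ge h)
    generalize (2:ℝ)^(2^j) = Z at *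
    calc (10:ℝ)^8 ≤ Z := this
      _ ≤ Z^4 := le_self_pow₀ (by linarith) (by norm_num)
  have hA : ((N/4:ℕ):ℝ) ≤ (N:ℝ)/4 := Nat.cast_div_le
  have hA0 : (0:ℝ) ≤ ((N/4:ℕ):ℝ) := Nat.cast_nonneg _
  have hP := Pi1_nonneg (j+8)
  have hv := V_nonneg N j
  clear e h hc1 hjj hj2
  generalize ∑ n ∈ Ioc (N/4) N, rI (j+8) n * fI N j n = S1 at *
  generalize ∑ n ∈ Ioc (N/4) N, rI (j+8) n = S0 at *
  generalize ((N/4:ℕ):ℝ) = A at *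
  generalize Pi1 (j+8) = P at *
  generalize V N j = v at *
  generalize (N:ℝ) = x at *
  have hE : (1/10^17) * (A + x + 2) ≤ (1/10^17) * (3*x) := by
    apply mul_le_mul_of_nonneg_left _ (by norm_num); linarith
  have hPv : 0 ≤ P * v := mul_nonneg hP hv
  have d1 := mul_le_mul_of_nonneg_right hE hPv
  have d0 := mul_le_mul_of_nonneg_right hE hP
  have b0 := abs_le.1 (a0.trans d0)
  have b1 := abs_le.1 (a1.trans d1)
  have f1 := mul_le_mul_of_nonneg_left b0.1 hv
  have f2 := mul_le_mul_of_nonneg_left b0.2 hv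
  have g : 0 ≤ x * (P * v) := mul_nonneg (by linarith) hPv
  have g2 : 0 ≤ A * (P * v) := mul_nonneg hA0 hPv
  constructor
  · rw [abs_le]
    constructor
    · linarith [b1.1]
    · linarith [b1.2]
  · linarith [b1.2]

lemma main_lb {N j : ℕ} (h : Hyp N j) :
    0.2 * (V N j * N) ≤ Real.log N * ∑ n ∈ Ioc (N/4) N, pI n * fI N j n := by
  refine le_trans ?_ (assemble N j)
  have t := mul_le_mul_of_nonneg_left (theta_part h) (V_nonneg N j)
  have d := abs_le.1 (DD_bound h)
  obtain ⟨s1, s2⟩ := sums_part h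
  have s3 := mul_le_mul_of_nonneg_left s1 (log_nn N)
  have s4 := mul_le_mul_of_nonneg_left (abs_le.1 s1).1 (log_nn N)
  have s5 := mul_le_mul_of_nonneg_left s2 log_four_nn
  have hy0 : 0 < yy j := by rw [yy_eq]; exact Nat.two_pow_pos _
  have q := mul_le_mul_of_nonneg_left (count_q (yy j) N hy0) (log_nn N)
  have lp := logPi h 8
  have hvn : 0 ≤ V N j * N := mul_nonneg (V_nonneg N j) (Nat.cast_nonneg N)
  have lp2 := mul_le_mul_of_nonneg_right lp hvn
  have hP : Pi1 (j+8) ≤ 1/1000 := by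
    have h1 := Pi1_le (j+8)
    have h2 : (2:ℝ)^11 ≤ 2^(j+8) := by
      apply pow_le_pow_right₀ (by norm_num)
      have := h.1
      exact Nat.add_le_add_right (le_trans (by norm_num) this) 8
    have h3 := Real.log_two_gt_d9
    have h4 : 1000 ≤ (2:ℝ)^(j+8) * Real.log 2 := by
      generalize (2:ℝ)^(j+8) = a at *
      nlinarith
    have h5 := Pi1_nonneg (j+8)
    have := mul_le_mul_of_nonneg_left h4 h5
    linarith
  have l4 : Real.log 4 ≤ 1.4 := by
    rw [show (4:ℝ) = 2^2 by norm_num, Real.log_pow]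
    have := Real.log_two_lt_d9
    push_cast; linarith
  have s6 : Real.log 4 * (2 * (N * Pi1 (j+8) * V N j)) ≤ 0.003 * (V N j * N) := by
    have : Real.log 4 * Pi1 (j+8) ≤ 1.4 * (1/1000) := mul_le_mul l4 hP (Pi1_nonneg _) (by norm_num)
    have := mul_le_mul_of_nonneg_right this hvn
    linarith
  have q2 : Real.log N * (N / yy j) ≤ 0.001 * (V N j * N) := by
    have b1 := log_small h
    have b3 := Z_ge j
    have b4 := V_ge N j
    have hl := log_nn N
    rw [yy_real]
    have hN := (Nat.cast_nonneg N : (0:ℝ) ≤ N)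
    clear q s1 s2 s3 s4 s5 lp lp2 hP d t s6
    generalize (2:ℝ)^(2^j) = Z at *
    generalize V N j = v at *
    have hZ : 0 < Z := by linarith
    have k1 : Real.log N / Z^256 ≤ 0.001 * v := by
      rw [div_le_iff₀ (by positivity)]
      have : 1/Z * Z^256 ≤ v * Z^256 := mul_le_mul_of_nonneg_right b4 (by positivity)
      have k2 : 1/Z * Z^256 = Z^255 := by field_simp
      have k3 : Z^2 ≤ Z^255 := pow_le_pow_right₀ (by linarith) (by norm_num)
      have k4 : Z^2 = Z * Z := sq Z
      linarith
    calc Real.log N * (N / Z^256) = N * (Real.log N / Z^256) := by ring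
      _ ≤ N * (0.001 * v) := mul_le_mul_of_nonneg_left k1 hN
      _ = _ := by ring
  norm_num at lp2
  linarith [d.2]

end CW

namespace CW
open Finset

def SP : Finset ℕ := pr 0 (2^128)

lemma mem_SP {l : ℕ} : l ∈ SP ↔ l ≤ 2^128 ∧ l.Prime := by
  unfold SP
  rw [mem_pr]
  exact ⟨fun h => h.2, fun h => ⟨h.2.pos, h⟩⟩

attribute [irreducible] SP

lemma harm (n : ℕ) : ∑ i ∈ Icc 1 n, (i:ℝ)⁻¹ ≤ 1 + Real.log n := by
  have h2 := harmonic_le_one_add_log n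
  rw [harmonic_eq_sum_Icc] at h2
  push_cast at h2
  exact h2

lemma SP_recip : ∑ l ∈ SP, 1/(l:ℝ) ≤ 90 := by
  have h1 : ∑ l ∈ SP, 1/(l:ℝ) ≤ ∑ l ∈ Icc 1 (2^128), ((l:ℕ):ℝ)⁻¹ := by
    simp only [one_div]
    apply sum_le_sum_of_subset_of_nonneg
    · intro l hl
      have := mem_SP.1 hl
      exact mem_Icc.2 ⟨this.2.pos, this.1⟩
    · intro l _ _; exact inv_nonneg.2 (Nat.cast_nonneg l)
  have h2 := harm (2^128)
  have h3 : Real.log ((2^128:ℕ):ℝ) = (128:ℕ) * Real.log 2 := by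
    rw [Nat.cast_pow, Real.log_pow]; norm_num
  rw [h3] at h2
  have := Real.log_two_lt_d9
  refine h1.trans (h2.trans ?_)
  push_cast
  linarith

lemma SP_recip40 : ∑ l ∈ SP, 1/(l:ℝ)^40 ≤ 1/2^38 := by
  have h1 : ∑ l ∈ SP, 1/(l:ℝ)^40 ≤ ∑ l ∈ Ioc 1 (2^128), (1/2^38) * (((l:ℕ):ℝ)^2)⁻¹ := by
    calc _ ≤ ∑ l ∈ SP, (1/2^38) * ((l:ℝ)^2)⁻¹ := by
          apply sum_le_sum
          intro l hl
          have h2 : (2:ℝ) ≤ l := by exact_mod_cast (mem_SP.1 hl).2.two_le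
          have h0 : (0:ℝ) < l := by linarith
          rw [← one_div, one_div_mul_one_div]
          apply one_div_le_one_div_of_le (by positivity)
          calc (2:ℝ)^38 * (l:ℝ)^2 ≤ (l:ℝ)^38 * (l:ℝ)^2 := by
                apply mul_le_mul_of_nonneg_right _ (by positivity)
                exact pow_le_pow_left₀ (by norm_num) h2 38
            _ = (l:ℝ)^40 := by rw [← pow_add]
      _ ≤ _ := by
          apply sum_le_sum_of_subset_of_nonneg
          · intro l hl
            have := mem_SP.1 hl
            exact mem_Ioc.2 ⟨this.2.one_lt, this.1⟩
          · intro l _ _; exact mul_nonneg (by norm_num) (inv_nonneg.2 (sq_nonneg _))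
  refine h1.trans ?_
  rw [← mul_sum]
  have h3 := sum_Ioc_inv_sq_le_sub (α := ℝ) one_ne_zero (Nat.one_le_two_pow (n := 128))
  have h4 : (0:ℝ) ≤ (((2^128:ℕ):ℝ))⁻¹ := inv_nonneg.2 (Nat.cast_nonneg _)
  have h5 : ∑ l ∈ Ioc 1 (2^128), (((l:ℕ):ℝ)^2)⁻¹ ≤ 1 := by
    refine h3.trans ?_
    rw [Nat.cast_one, inv_one]
    linarith
  calc _ ≤ (1/2^38) * (1:ℝ) := mul_le_mul_of_nonneg_left h5 (by norm_num)
    _ = _ := mul_one _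

open Classical in
noncomputable def dI (d m : ℕ) : ℝ := if d ∣ m then 1 else 0

lemma dI_nonneg (d m : ℕ) : 0 ≤ dI d m := by unfold dI; split_ifs <;> norm_num

noncomputable def WW (m : ℕ) : ℝ := ∑ l ∈ SP, (dI l m + 10^9 * dI (l^40) m)

lemma hX2 {N j : ℕ} (h : Hyp N j) (l e : ℕ) (hl : l ≤ 2^128) (he : e ≤ 40) : 2^(2^j*220) * l^e ≤ N+1 := by
  have h1 : l^e ≤ 2^(2^j) := by
    calc l^e ≤ (2^128)^e := Nat.pow_le_pow_left hl e
      _ = 2^(128*e) := by rw [← pow_mul]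
      _ ≤ 2^(2^j) := by
          apply Nat.pow_le_pow_right (by norm_num)
          calc 128*e ≤ 128 * 40 := Nat.mul_le_mul_left _ he
            _ ≤ 2^13 := by norm_num
            _ ≤ 2^j := Nat.pow_le_pow_right (by norm_num) (le_trans (by norm_num) h.1)
  refine (Nat.mul_le_mul_left _ h1).trans (le_trans ?_ (h.2.1.trans (Nat.le_succ N)))
  rw [← pow_add]
  apply Nat.pow_le_pow_right (by norm_num)
  omega

lemma cop_one {N j : ℕ} : Cop N j {1} := by
  intro p hp l hl hd
  rw [mem_singleton] at hp
  subst hp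
  exact (mem_LL.1 hl).2.2.1.one_lt.ne' (Nat.dvd_one.1 hd)

lemma z_lt {N j n : ℕ} (h : Hyp N j) (hn : n ∈ Ioc (N/4) N) : 2^(2^j) < n := by
  refine lt_of_le_of_lt ?_ (mem_Ioc.1 hn).1
  refine le_trans ?_ (quarter h)
  apply Nat.pow_le_pow_right (by norm_num)
  calc 2^j ≤ 2^(j+8) := Nat.pow_le_pow_right (by norm_num) (Nat.le_add_right j 8)
    _ ≤ _ := Nat.le_mul_of_pos_right _ (by norm_num)

lemma count_small {N j : ℕ} (h : Hyp N j) (l e : ℕ) (hl : l ∈ SP) (he : e ≤ 40) :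
    ∑ n ∈ Ioc (N/4) N, pI n * fI N j n * dI (l^e) (N-n) ≤ 10 * (N * (Pi1 j * V N j)) * (1 / (l:ℝ)^e) := by
  classical
  have hl1 := mem_SP.1 hl
  have hj2 : 2 ≤ j := le_trans (by norm_num) h.1
  have hlP : l ∈ PP j := by
    refine mem_pr.2 ⟨hl1.2.pos, hl1.1.trans ?_, hl1.2⟩
    apply Nat.pow_le_pow_right (by norm_num)
    calc 128 = 2^7 := by norm_num
      _ ≤ 2^j := Nat.pow_le_pow_right (by norm_num) (le_trans (by norm_num) h.1)
  have hWc : #(Wc N j {1} l) = 1 := card_Wc' (fun hc => absurd (mem_LL.1 hc).1 (not_lt.2 hl1.1))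
  have key := SVAP hj2 (adm_Wc (N := N) (j := j) cop_one (by simp)) (N+1) l e (N % l^e) hlP hWc
    (hX2 h l e hl1.1 he) (Nat.mod_lt _ (pow_pos hl1.2.pos e))
  rw [dens_one le_rfl cop_one] at key
  have hle : ∑ n ∈ Ioc (N/4) N, pI n * fI N j n * dI (l^e) (N-n) ≤
      (#{n ∈ range (N+1) | Sif (PP j) (Wc N j {1}) n ∧ n % l^e = N % l^e} : ℝ) := by
    rw [card_filter]
    push_cast
    have hsub : Ioc (N/4) N ⊆ range (N+1) := by
      intro n hn; exact mem_range.2 (Nat.lt_succ_of_le (mem_Ioc.1 hn).2)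
    refine le_trans ?_ (sum_le_sum_of_subset_of_nonneg hsub (fun n _ _ => by split_ifs <;> norm_num))
    apply sum_le_sum
    intro n hn
    by_cases hc : n.Prime ∧ FF N j n ∧ l^e ∣ N - n
    · rw [if_pos]
      · unfold pI fI dI
        rw [if_pos hc.1, if_pos hc.2.1, if_pos hc.2.2]; norm_num
      · refine ⟨(sif_iff le_rfl cop_one n).2 ⟨rough_prime hc.1 (z_lt h hn), ?_⟩, ?_⟩
        · intro p hp
          rw [mem_singleton] at hp
          rw [hp, mul_one]; exact hc.2.1
        · exact (Nat.modEq_iff_dvd' (mem_Ioc.1 hn).2).2 hc.2.2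
    · have : pI n * fI N j n * dI (l^e) (N-n) = 0 := by
        unfold pI fI dI
        by_cases c1 : n.Prime
        · by_cases c2 : FF N j n
          · rw [if_neg (fun c3 => hc ⟨c1, c2, c3⟩)]; ring
          · rw [if_neg c2]; ring
        · rw [if_neg c1]; ring
      rw [this]
      split_ifs <;> norm_num
  refine hle.trans (key.trans ?_)
  have hN1 : (1:ℝ) ≤ N := Nat.one_le_cast.2 (le_trans Nat.one_le_two_pow h.2.1)
  have hl0 : (0:ℝ) ≤ 1/(l:ℝ)^e := one_div_nonneg.2 (pow_nonneg (Nat.cast_nonneg l) e)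
  have hPV : 0 ≤ Pi1 j * V N j := mul_nonneg (Pi1_nonneg j) (V_nonneg N j)
  have hh := mul_nonneg hl0 hPV
  calc 5 * (((N+1:ℕ):ℝ) / (l:ℝ)^e) * (Pi1 j * V N j) = 5 * (N+1) * (1/(l:ℝ)^e * (Pi1 j * V N j)) := by push_cast; ring
    _ ≤ 10 * N * (1/(l:ℝ)^e * (Pi1 j * V N j)) := by
        apply mul_le_mul_of_nonneg_right _ hh; linarith
    _ = _ := by ring

lemma WW_total {N j : ℕ} (h : Hyp N j) :
    Real.log N * ∑ n ∈ Ioc (N/4) N, pI n * fI N j n * WW (N-n) ≤ 1.2 * 10^8 * (V N j * N) := by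
  have e : ∑ n ∈ Ioc (N/4) N, pI n * fI N j n * WW (N-n) =
      ∑ l ∈ SP, (∑ n ∈ Ioc (N/4) N, pI n * fI N j n * dI (l^1) (N-n)
        + 10^9 * ∑ n ∈ Ioc (N/4) N, pI n * fI N j n * dI (l^40) (N-n)) := by
    unfold WW
    simp only [mul_sum, ← sum_add_distrib]
    rw [sum_comm]
    apply sum_congr rfl
    intro l _
    apply sum_congr rfl
    intro n _
    rw [pow_one]; ring
  set A := 10 * (N * (Pi1 j * V N j)) with hA
  have hA0 : 0 ≤ A := mul_nonneg (by norm_num) (mul_nonneg (Nat.cast_nonneg N) (mul_nonneg (Pi1_nonneg j) (V_nonneg N j)))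
  have b : ∑ n ∈ Ioc (N/4) N, pI n * fI N j n * WW (N-n) ≤ A * 91 := by
    rw [e]
    calc _ ≤ ∑ l ∈ SP, (A * (1/(l:ℝ)) + 10^9 * (A * (1/(l:ℝ)^40))) := by
          apply sum_le_sum
          intro l hl
          have c1 := count_small h l 1 hl (by norm_num)
          have c2 := count_small h l 40 hl le_rfl
          rw [pow_one (l:ℝ)] at c1
          exact add_le_add c1 (mul_le_mul_of_nonneg_left c2 (by norm_num))
      _ = A * (∑ l ∈ SP, 1/(l:ℝ) + 10^9 * ∑ l ∈ SP, 1/(l:ℝ)^40) := by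
          rw [sum_add_distrib, ← mul_sum, ← mul_sum, ← mul_sum]; ring
      _ ≤ A * 91 := by
          apply mul_le_mul_of_nonneg_left _ hA0
          have c1 := SP_recip
          have c2 := mul_le_mul_of_nonneg_left SP_recip40 (by norm_num : (0:ℝ) ≤ 10^9)
          have c3 : (10:ℝ)^9 * (1/2^38) ≤ 1 := by norm_num
          linarith
  have b2 := mul_le_mul_of_nonneg_left b (log_nn N)
  have lp := logPi h 0
  simp only [add_zero, pow_zero, div_one] at lp
  have hvn : 0 ≤ V N j * N := mul_nonneg (V_nonneg N j) (Nat.cast_nonneg N)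
  have lp2 := mul_le_mul_of_nonneg_right lp hvn
  calc _ ≤ _ := b2
    _ = 910 * (Real.log N * Pi1 j * (V N j * N)) := by rw [hA]; ring
    _ ≤ 910 * (2^17 * (V N j * N)) := mul_le_mul_of_nonneg_left lp2 (by norm_num)
    _ = (910 * 2^17) * (V N j * N) := by ring
    _ ≤ _ := mul_le_mul_of_nonneg_right (by norm_num) hvn

lemma exists_good {N j : ℕ} (h : Hyp N j) : ∃ n ∈ Ioc (N/4) N, n.Prime ∧ FF N j n ∧ WW (N-n) < 10^9 := by
  by_contra hc
  push Not at hc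
  have h1 := main_lb h
  have h2 := WW_total h
  have h3 : 10^9 * ∑ n ∈ Ioc (N/4) N, pI n * fI N j n ≤ ∑ n ∈ Ioc (N/4) N, pI n * fI N j n * WW (N-n) := by
    rw [mul_sum]
    apply sum_le_sum
    intro n hn
    by_cases c1 : n.Prime
    · by_cases c2 : FF N j n
      · have := hc n hn c1 c2
        rw [mul_comm]
        exact mul_le_mul_of_nonneg_left this (mul_nonneg (pI_nonneg n) (fI_nonneg N j n))
      · have : fI N j n = 0 := by unfold fI; rw [if_neg c2]
        rw [this]; simp
    · have : pI n = 0 := by unfold pI; rw [if_neg c1]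
      rw [this]; simp
  have h4 := mul_le_mul_of_nonneg_left h3 (log_nn N)
  have hN1 : (1:ℝ) ≤ N := Nat.one_le_cast.2 (le_trans Nat.one_le_two_pow h.2.1)
  have hv : 0 < V N j := lt_of_lt_of_le (one_div_pos.2 (pow_pos (by norm_num) _)) (V_ge N j)
  have hvn : 0 < V N j * N := mul_pos hv (by linarith)
  linarith

end CW

namespace CW
open Finset

lemma length_eq (m : ℕ) : m.primeFactorsList.length = ∑ p ∈ m.primeFactors, m.factorization p := by
  rw [← List.sum_toFinset_count_eq_length]
  apply sum_congr rfl
  intro p _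
  exact Nat.primeFactorsList_count_eq

lemma omega_split (m z A B T : ℕ) (hm : 0 < m) (hz : 1 < z) (hmT : m < z^T)
    (hsm : ∀ p ∈ m.primeFactors, p ≤ z → m.factorization p ≤ A)
    (hcard : #{p ∈ m.primeFactors | p ≤ z} ≤ B) : m.primeFactorsList.length ≤ B*A + T := by
  rw [length_eq, ← sum_filter_add_sum_filter_not _ (fun p => p ≤ z)]
  apply add_le_add
  · calc _ ≤ #{p ∈ m.primeFactors | p ≤ z} * A := by
          rw [← smul_eq_mul]
          apply sum_le_card_nsmul
          intro p hp
          rw [mem_filter] at hp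
          exact hsm p hp.1 hp.2
      _ ≤ B * A := Nat.mul_le_mul_right A hcard
  · have h1 : z^(∑ p ∈ m.primeFactors with ¬ p ≤ z, m.factorization p) ≤ m := by
      rw [← prod_pow_eq_pow_sum]
      calc _ ≤ ∏ p ∈ m.primeFactors with ¬ p ≤ z, p^(m.factorization p) := by
            apply prod_le_prod' 
            intro p hp
            rw [mem_filter] at hp
            exact Nat.pow_le_pow_left (not_le.1 hp.2).le _
        _ ≤ ∏ p ∈ m.primeFactors, p^(m.factorization p) := by
            apply prod_le_prod_of_subset_of_one_le' (filter_subset _ _)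
            intro p hp _
            exact Nat.one_le_iff_ne_zero.2 (pow_ne_zero _ (Nat.prime_of_mem_primeFactors hp).ne_zero)
        _ = m := Nat.prod_factorization_pow_eq_self hm.ne'
    exact ((Nat.pow_lt_pow_iff_right hz).1 (lt_of_le_of_lt h1 hmT)).le

lemma WW_ge (m l : ℕ) (hl : l ∈ SP) (hd : l^40 ∣ m) : 10^9 ≤ WW m := by
  unfold WW
  have : (10:ℝ)^9 ≤ dI l m + 10^9 * dI (l^40) m := by
    have h1 : dI (l^40) m = 1 := by unfold dI; rw [if_pos hd]
    have h2 := dI_nonneg l m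
    rw [h1]; linarith
  refine this.trans (single_le_sum (f := fun l => dI l m + 10^9 * dI (l^40) m) ?_ hl)
  intro l _
  exact add_nonneg (dI_nonneg _ _) (mul_nonneg (by norm_num) (dI_nonneg _ _))

lemma WW_card (m : ℕ) (S : Finset ℕ) (hS : S ⊆ SP) (hd : ∀ l ∈ S, l ∣ m) : (#S : ℝ) ≤ WW m := by
  unfold WW
  calc (#S : ℝ) = ∑ l ∈ S, (1:ℝ) := by simp
    _ ≤ ∑ l ∈ S, (dI l m + 10^9 * dI (l^40) m) := by
        apply sum_le_sum
        intro l hl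
        have h1 : dI l m = 1 := by unfold dI; rw [if_pos (hd l hl)]
        have h2 := dI_nonneg (l^40) m
        rw [h1]; linarith
    _ ≤ _ := by
        apply sum_le_sum_of_subset_of_nonneg hS
        intro l _ _
        exact add_nonneg (dI_nonneg _ _) (mul_nonneg (by norm_num) (dI_nonneg _ _))

lemma large_case {N j : ℕ} (h : Hyp N j) (hev : Even N) :
    ∃ p m : ℕ, p.Prime ∧ 0 < m ∧ m.primeFactorsList.length ≤ 2^41 ∧ N = p + m := by
  obtain ⟨n, hn, hp, hF, hW⟩ := exists_good h
  have hn1 := mem_Ioc.1 hn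
  have hzn := z_lt h hn
  have hn2 : 2 < n := lt_of_le_of_lt (by
    calc 2 = 2^1 := by norm_num
      _ ≤ 2^(2^j) := Nat.pow_le_pow_right (by norm_num) Nat.one_le_two_pow) hzn
  have hne : n ≠ N := by
    intro e
    rw [← e] at hev
    have := (hp.even_iff).1 hev
    exact absurd this (Nat.ne_of_gt hn2)
  have hlt : n < N := lt_of_le_of_ne hn1.2 hne
  refine ⟨n, N - n, hp, Nat.sub_pos_of_lt hlt, ?_, (Nat.add_sub_cancel' hn1.2).symm⟩
  have hm : 0 < N - n := Nat.sub_pos_of_lt hlt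
  have hmN : N - n < (2^(2^j))^(2^17) := by
    rw [← pow_mul]
    exact lt_of_le_of_lt (Nat.sub_le _ _) h.2.2
  have hsmall : ∀ p ∈ (N-n).primeFactors, p ≤ 2^(2^j) → p ∈ SP := by
    intro p hpf hpz
    have hpp := Nat.prime_of_mem_primeFactors hpf
    have hpd := Nat.dvd_of_mem_primeFactors hpf
    rw [mem_SP]
    refine ⟨?_, hpp⟩
    by_contra hc
    have hmod : n ≡ N [MOD p] := (Nat.modEq_iff_dvd' hn1.2).2 hpd
    by_cases hpN : p ∣ N
    · have : p ∣ n := (hmod.dvd_iff dvd_rfl).2 hpN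
      have := (Nat.prime_dvd_prime_iff_eq hpp hp).1 this
      exact absurd hzn (not_lt.2 (this ▸ hpz))
    · exact hF p (mem_LL.2 ⟨not_le.1 hc, hpz, hpp, hpN⟩) ((ZMod.natCast_eq_natCast_iff _ _ _).2 hmod)
  have hz1 : 1 < 2^(2^j) := Nat.one_lt_two_pow (pow_ne_zero _ (by norm_num))
  have main := omega_split (N-n) (2^(2^j)) 39 (10^9) (2^17) hm hz1 hmN (by
      intro p hpf hpz
      by_contra hc
      have hpp := Nat.prime_of_mem_primeFactors hpf
      have : p^40 ∣ N - n := (hpp.pow_dvd_iff_le_factorization hm.ne').2 (Nat.succ_le_of_lt (not_le.1 hc))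
      exact absurd (WW_ge (N-n) p (hsmall p hpf hpz) this) (not_le.2 hW)) (by
      have := WW_card (N-n) {p ∈ (N-n).primeFactors | p ≤ 2^(2^j)} (by
        intro p hpf
        rw [mem_filter] at hpf
        exact hsmall p hpf.1 hpf.2) (by
        intro p hpf
        rw [mem_filter] at hpf
        exact Nat.dvd_of_mem_primeFactors hpf.1)
      have h2 := this.trans hW.le
      exact_mod_cast h2)
  refine main.trans ?_
  norm_num

lemma exp_big : (2:ℝ)^41 ≤ Real.exp 29.3 := by
  have h1 := Real.exp_one_gt_d9
  have h2 : (2.718:ℝ)^29 ≤ (Real.exp 1)^29 := pow_le_pow_left₀ (by norm_num) (by linarith) 29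
  rw [← Real.exp_nat_mul] at h2
  have h3 : Real.exp ((29:ℕ) * 1) ≤ Real.exp 29.3 := Real.exp_le_exp.2 (by norm_num)
  refine le_trans ?_ (h2.trans h3)
  norm_num

lemma small_case {N : ℕ} (hN4 : 4 ≤ N) (hs : Nat.log 2 N ≤ 2^41) :
    ∃ p m : ℕ, p.Prime ∧ 0 < m ∧ m.primeFactorsList.length ≤ 2^41 ∧ N = p + m := by
  refine ⟨2, N - 2, Nat.prime_two, by omega, ?_, by omega⟩
  refine le_trans ?_ hs
  apply Nat.le_log_of_pow_le (by norm_num)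
  have hm : N - 2 ≠ 0 := by omega
  calc 2^((N-2).primeFactorsList.length) ≤ (N-2).primeFactorsList.prod := by
        apply List.pow_card_le_prod
        intro p hp
        exact (Nat.prime_of_mem_primeFactorsList hp).two_le
    _ = N - 2 := Nat.prod_primeFactorsList hm
    _ ≤ N := Nat.sub_le _ _

lemma get_j (L : ℕ) (hL : 2^41 ≤ L) : ∃ j, 25 ≤ j ∧ 2^j * 2^16 ≤ L ∧ L < 2^j * 2^17 := by
  have hL0 : L ≠ 0 := Nat.ne_of_gt (lt_of_lt_of_le (by norm_num) hL)
  have h1 : 41 ≤ Nat.log 2 L := Nat.le_log_of_pow_le (by norm_num) hL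
  refine ⟨Nat.log 2 L - 16, by omega, ?_, ?_⟩
  · rw [← pow_add, Nat.sub_add_cancel (by omega)]
    exact Nat.pow_log_le_self 2 hL0
  · rw [← pow_add, show Nat.log 2 L - 16 + 17 = Nat.log 2 L + 1 by omega]
    exact Nat.lt_pow_succ_log_self (by norm_num) L

lemma get_hyp {N : ℕ} (hN : N ≠ 0) (hL : 2^41 ≤ Nat.log 2 N) : ∃ j, Hyp N j := by
  obtain ⟨j, h1, h2, h3⟩ := get_j _ hL
  refine ⟨j, h1, ?_, ?_⟩
  · exact (Nat.pow_le_pow_right (by norm_num) h2).trans (Nat.pow_log_le_self 2 hN)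
  · exact (Nat.lt_pow_succ_log_self (by norm_num) N).trans_le (Nat.pow_le_pow_right (by norm_num) h3)

lemma final (N : ℕ) (hN : Even N) (hN4 : 4 ≤ N) :
    ∃ p m : ℕ, p.Prime ∧ 0 < m ∧ m.primeFactorsList.length ≤ 2^41 ∧ N = p + m := by
  rcases le_total (Nat.log 2 N) (2^41) with h | h
  · exact small_case hN4 h
  · obtain ⟨j, hj⟩ := get_hyp (by omega) h
    exact large_case hj hN

end CW

open Real

/-- Every even integer `N ≥ 4` is the sum of a prime and a positive integer that is a
product of at most `exp 29.3` primes (counted with multiplicity). -/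
theorem chen_weak (N : ℕ) (hN : Even N) (hN4 : 4 ≤ N) :
    ∃ p m : ℕ, Nat.Prime p ∧ 0 < m ∧
      (m.primeFactorsList.length : ℝ) ≤ Real.exp 29.3 ∧ N = p + m := by
  obtain ⟨p, m, h1, h2, h3, h4⟩ := CW.final N hN hN4
  refine ⟨p, m, h1, h2, ?_, h4⟩
  have h5 : ((m.primeFactorsList.length : ℕ) : ℝ) ≤ ((2^41 : ℕ) : ℝ) := Nat.cast_le.2 h3
  rw [Nat.cast_pow, Nat.cast_ofNat] at h5
  exact h5.trans CW.exp_big
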